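/- arXiv:1203.6795 — 9 statements merged into one kernel-verified Lean document; each statement's English description precedes it below -/
import Mathlib

section
/- Let S be a finite lattice and X ⊆ S^ℤ a nonempty subshift with B_1(X) = S that is closed under the cellwise operations ⊓ and ⊔. Then for every a ∈ S, the configurations m^a and M^a belong to X. -/
/-- The shift map on the full shift `ℤ → α`. -/
def shiftMap {α : Type*} (x : ℤ → α) : ℤ → α := fun i => x (i + 1)

/-- `X` is a subshift: shift-invariant (`σ(X) = X`) and closed. -/
def IsSubshift {α : Type*} (X : Set (ℤ → α)) : Prop :=
  (∀ x ∈ X, shiftMap x ∈ X) ∧ (∀ x ∈ X, ∃ y ∈ X, shiftMap y = x) ∧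
    ∀ x : ℤ → α, (∀ n : ℕ, ∃ y ∈ X, ∀ i : ℤ, |i| ≤ (n : ℤ) → y i = x i) → x ∈ X

/-- A finite nonempty inf-closed set contains its greatest lower bound. -/
theorem InfClosed.isGLB_mem {α : Type*} [SemilatticeInf α] {s : Set α} (hs : InfClosed s)
    (hfin : s.Finite) (hne : s.Nonempty) {a : α} (ha : IsGLB s a) : a ∈ s := by
  obtain ⟨b, hb⟩ := hfin.exists_minimal hne
  have hleast : IsLeast s b :=
    ⟨hb.1, fun c hc => (hb.2 (hs hb.1 hc) inf_le_left).trans inf_le_right⟩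
  exact hleast.isGLB.unique ha ▸ hb.1

/-- An inf-closed set of functions into a finite semilattice contains, for each finite set of
coordinates, a function agreeing there with the pointwise greatest lower bound. -/
theorem InfClosed.exists_eqOn_finset_of_isGLB {ι α : Type*} [SemilatticeInf α] [Finite α]
    {F : Set (ι → α)} (hF : InfClosed F) (hne : F.Nonempty) {m : ι → α}
    (hm : ∀ i, IsGLB ((fun x : ι → α => x i) '' F) (m i)) (I : Finset ι) :
    ∃ y ∈ F, ∀ i ∈ I, y i = m i := by
  classical
  induction I using Finset.induction_on with
  | empty => exact hne.imp fun y hy => ⟨hy, by simp⟩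
  | insert j I _ ih =>
    obtain ⟨y, hy, hyI⟩ := ih
    have himage : InfClosed ((fun x : ι → α => x j) '' F) := by
      rintro _ ⟨u, hu, rfl⟩ _ ⟨v, hv, rfl⟩
      exact ⟨u ⊓ v, hF hu hv, rfl⟩
    obtain ⟨z, hz, hzj⟩ := himage.isGLB_mem (Set.toFinite _) (hne.image _) (hm j)
    have hle : ∀ x ∈ F, ∀ i, m i ≤ x i := fun x hx i => (hm i).1 ⟨x, hx, rfl⟩
    refine ⟨y ⊓ z, hF hy hz, fun i hi => ?_⟩
    rcases Finset.mem_insert.1 hi with rfl | hi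
    · exact (inf_eq_right.2 (hzj.trans_le (hle y hy i))).trans hzj
    · exact (inf_eq_left.2 ((hyI i hi).trans_le (hle z hz i))).trans (hyI i hi)

/-- A subshift contains the pointwise greatest lower bound of each of its nonempty inf-closed
subsets. -/
theorem IsSubshift.mem_of_isGLB {α : Type*} [SemilatticeInf α] [Finite α]
    {X F : Set (ℤ → α)} (hX : IsSubshift X) (hFX : F ⊆ X) (hF : InfClosed F) (hne : F.Nonempty)
    {m : ℤ → α} (hm : ∀ i, IsGLB ((fun x : ℤ → α => x i) '' F) (m i)) : m ∈ X := by
  refine hX.2.2 m fun n => ?_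
  obtain ⟨y, hy, hym⟩ := hF.exists_eqOn_finset_of_isGLB hne hm (Finset.Icc (-(n : ℤ)) n)
  exact ⟨y, hFX hy, fun i hi => hym i (Finset.mem_Icc.2 (abs_le.1 hi))⟩

/-- For a cellwise lattice subshift `X` with full one-letter language,
the configurations `m^a` and `M^a` belong to `X`. -/
theorem stmt1 {S : Type*} [Fintype S] [Lattice S]
    (X : Set (ℤ → S)) (hX : IsSubshift X) (hne : X.Nonempty)
    (hB1 : ∀ a : S, ∃ x ∈ X, x 0 = a)
    (hops : ∀ x ∈ X, ∀ y ∈ X, (fun i => x i ⊓ y i) ∈ X ∧ (fun i => x i ⊔ y i) ∈ X)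
    (m M : S → ℤ → S)
    (hm : ∀ (a : S) (i : ℤ), IsGLB ((fun x : ℤ → S => x i) '' {x ∈ X | a ≤ x 0}) (m a i))
    (hM : ∀ (a : S) (i : ℤ), IsLUB ((fun x : ℤ → S => x i) '' {x ∈ X | x 0 ≤ a}) (M a i)) :
    ∀ a : S, m a ∈ X ∧ M a ∈ X := by
  intro a
  obtain ⟨x, hx, hxa⟩ := hB1 a
  constructor
  · exact hX.mem_of_isGLB (F := {x ∈ X | a ≤ x 0}) (fun _ h => h.1)
      (fun y hy z hz => ⟨(hops y hy.1 z hz.1).1, le_inf hy.2 hz.2⟩) ⟨x, hx, hxa.ge⟩ (hm a)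
  · exact IsSubshift.mem_of_isGLB (α := Sᵒᵈ) (X := X) (F := {x : ℤ → S | x ∈ X ∧ x 0 ≤ a}) hX
      (fun _ h => h.1)
      (fun y hy z hz => ⟨(hops y hy.1 z hz.1).2, sup_le (α := S) hy.2 hz.2⟩)
      ⟨x, hx, hxa.le⟩ (hM a)
end

section
/- Let S be a finite lattice and X ⊆ S^ℤ a nonempty subshift with B_1(X) = S that is closed under the cellwise operations ⊓ and ⊔. Then X is sofic if and only if for every a ∈ S both configurations m^a and M^a are eventually periodic in both directions. -/
/-- `X` is a shift of finite type: it is defined by a set `W` of allowed words of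
some length `n ≥ 1`. -/
def IsSFT {α : Type*} (X : Set (ℤ → α)) : Prop :=
  ∃ n : ℕ, 0 < n ∧ ∃ W : Set (Fin n → α),
    X = {x : ℤ → α | ∀ i : ℤ, (fun k : Fin n => x (i + (k : ℕ))) ∈ W}

/-- `X` is sofic: it is the image of an SFT over some finite alphabet `T`
under a block map given by a local rule `g` of radius `r`. -/
def IsSofic {α : Type*} (X : Set (ℤ → α)) : Prop :=
  ∃ (T : Type) (_ : Fintype T) (Y : Set (ℤ → T)) (r : ℕ) (g : (Fin (2 * r + 1) → T) → α),
    IsSFT Y ∧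
    (fun y : ℤ → T => fun i : ℤ => g (fun k => y (i - (r : ℤ) + (k : ℕ)))) '' Y = X

/-- `z` is eventually periodic in both directions. -/
def EvPeriodicBoth {α : Type*} (z : ℤ → α) : Prop :=
  ∃ p q : ℕ, 0 < p ∧ 0 < q ∧ ∃ N : ℕ,
    (∀ i : ℤ, (N : ℤ) ≤ i → z (i + (p : ℤ)) = z i) ∧
    (∀ i : ℤ, i ≤ -(N : ℤ) → z (i - (q : ℤ)) = z i)

/-- `X` is the set of label sequences of bi-infinite paths in a finite vertex-labelled graph. -/
def IsGraphSofic {α : Type*} (X : Set (ℤ → α)) : Prop :=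
  ∃ (T : Type) (_ : Finite T) (E : T → T → Prop) (l : T → α),
    X = {x | ∃ y : ℤ → T, (∀ i, E (y i) (y (i + 1))) ∧ ∀ i, l (y i) = x i}

theorem isGraphSofic_of_finite {α T : Type*} [Finite T] (E : T → T → Prop) (l : T → α) :
    IsGraphSofic {x | ∃ y : ℤ → T, (∀ i, E (y i) (y (i + 1))) ∧ ∀ i, l (y i) = x i} := by
  obtain ⟨n, ⟨e⟩⟩ := Finite.exists_equiv_fin T
  refine ⟨Fin n, inferInstance, fun a b => E (e.symm a) (e.symm b), fun a => l (e.symm a), ?_⟩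
  ext x
  constructor
  · rintro ⟨y, h1, h2⟩
    exact ⟨fun i => e (y i), by simpa using h1, by simpa using h2⟩
  · rintro ⟨y, h1, h2⟩
    exact ⟨fun i => e.symm (y i), h1, h2⟩

theorem IsGraphSofic.isSofic {α : Type*} {X : Set (ℤ → α)} (h : IsGraphSofic X) : IsSofic X := by
  obtain ⟨T, hT, E, l, rfl⟩ := h
  refine ⟨T, Fintype.ofFinite T, {y | ∀ i, E (y i) (y (i + 1))}, 0, fun w => l (w 0),
    ⟨2, by norm_num, {w | E (w 0) (w 1)}, ?_⟩, ?_⟩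
  · ext y
    simp
  · ext x
    constructor
    · rintro ⟨y, h1, rfl⟩
      exact ⟨y, h1, fun i => by simp⟩
    · rintro ⟨y, h1, h2⟩
      exact ⟨y, h1, funext fun i => by simpa using h2 i⟩

theorem IsSofic.isGraphSofic {α : Type*} {X : Set (ℤ → α)} (h : IsSofic X) : IsGraphSofic X := by
  obtain ⟨T, hT, Y, r, g, ⟨n, hn, W, rfl⟩, rfl⟩ := h
  let L := n + (2 * r + 1)
  convert isGraphSofic_of_finite (T := Fin L → T)
    (fun w w' => (∀ k k' : Fin L, (k' : ℕ) + 1 = k → w k = w' k') ∧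
      (fun k : Fin n => w ⟨k, by omega⟩) ∈ W)
    (fun w => g fun k => w ⟨k, by omega⟩) using 1
  ext x
  constructor
  · rintro ⟨y, hy, rfl⟩
    refine ⟨fun i k => y (i - r + (k : ℕ)), fun i => ⟨fun k k' hk => ?_, ?_⟩, fun i => rfl⟩
    · change y (i - r + (k : ℕ)) = y (i + 1 - r + (k' : ℕ))
      rw [← hk]
      congr 1
      push_cast
      ring
    · exact hy (i - r)
  · rintro ⟨y, hy, hx⟩
    have key : ∀ (k : ℕ) (hk : k < L) (i : ℤ), y i ⟨k, hk⟩ = y (i + k) ⟨0, by omega⟩ := by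
      intro k
      induction k with
      | zero => intro hk i; simp
      | succ k ih =>
        intro hk i
        rw [(hy i).1 ⟨k + 1, hk⟩ ⟨k, by omega⟩ rfl, ih]
        congr 1
        push_cast
        ring_nf
    refine ⟨fun i => y (i + r) ⟨0, by omega⟩, fun i => ?_, funext fun i => ?_⟩
    · convert (hy (i + r)).2 using 1
      ext k
      rw [key]
      ring_nf
    · rw [← hx i]
      refine congrArg g (funext fun k => ?_)
      rw [key]
      ring_nf

theorem IsGraphSofic.reflect {α : Type*} {X : Set (ℤ → α)} (h : IsGraphSofic X) :
    IsGraphSofic {x | (fun i => x (-i)) ∈ X} := by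
  obtain ⟨T, hT, E, l, rfl⟩ := h
  refine ⟨T, hT, fun a b => E b a, l, ?_⟩
  ext x
  constructor
  · rintro ⟨y, h1, h2⟩
    refine ⟨fun i => y (-i), fun i => ?_, fun i => by simpa using h2 (-i)⟩
    have := h1 (-(i + 1))
    rwa [show -(i + 1) + 1 = -i by ring] at this
  · rintro ⟨y, h1, h2⟩
    refine ⟨fun i => y (-i), fun i => ?_, fun i => h2 (-i)⟩
    have := h1 (-(i + 1))
    rwa [show -(i + 1) + 1 = -i by ring] at this

theorem IsGraphSofic.inter {α : Type*} {X Y : Set (ℤ → α)} (hX : IsGraphSofic X)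
    (hY : IsGraphSofic Y) : IsGraphSofic (X ∩ Y) := by
  obtain ⟨T, hT, E, l, rfl⟩ := hX
  obtain ⟨T', hT', E', l', rfl⟩ := hY
  convert isGraphSofic_of_finite (T := {t : T × T' // l t.1 = l' t.2})
    (fun a b => E a.1.1 b.1.1 ∧ E' a.1.2 b.1.2) (fun a => l a.1.1) using 1
  ext x
  constructor
  · rintro ⟨⟨y, h1, h2⟩, ⟨y', h1', h2'⟩⟩
    exact ⟨fun i => ⟨(y i, y' i), (h2 i).trans (h2' i).symm⟩, fun i => ⟨h1 i, h1' i⟩, h2⟩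
  · rintro ⟨y, h1, h2⟩
    exact ⟨⟨fun i => (y i).1.1, fun i => (h1 i).1, h2⟩,
      ⟨fun i => (y i).1.2, fun i => (h1 i).2, fun i => (y i).2.symm.trans (h2 i)⟩⟩

/-- The one-sided sequence `f` is eventually periodic. -/
def EvPeriodic {α : Type*} (f : ℕ → α) : Prop :=
  ∃ p N : ℕ, 0 < p ∧ ∀ n, N ≤ n → f (n + p) = f n

theorem evPeriodicBoth_iff {α : Type*} (z : ℤ → α) :
    EvPeriodicBoth z ↔ EvPeriodic (fun n : ℕ => z n) ∧ EvPeriodic (fun n : ℕ => z (-n)) := by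
  constructor
  · rintro ⟨p, q, hp, hq, N, h1, h2⟩
    refine ⟨⟨p, N, hp, fun n hn => ?_⟩, ⟨q, N, hq, fun n hn => ?_⟩⟩
    · simpa using h1 n (by omega)
    · change z (-(n + q : ℕ)) = z (-n)
      rw [← h2 (-n) (by omega)]
      congr 1
      push_cast
      ring
  · rintro ⟨⟨p, N, hp, h1⟩, ⟨q, N', hq, h2⟩⟩
    refine ⟨p, q, hp, hq, N + N', fun i hi => ?_, fun i hi => ?_⟩
    · have := h1 i.toNat (by omega)
      simpa [show ((i.toNat : ℕ) : ℤ) = i by omega] using this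
    · have : z (-((-i).toNat + q : ℕ)) = z (-((-i).toNat : ℕ)) := h2 (-i).toNat (by omega)
      rw [← show -(((-i).toNat : ℕ) : ℤ) = i by omega, ← this]
      congr 1
      push_cast
      ring

theorem evPeriodic_of_succ_eq {α : Type*} [Finite α] {f : ℕ → α} (F : α → α)
    (h : ∀ n, f (n + 1) = F (f n)) : EvPeriodic f := by
  obtain ⟨a, b, hab, hf⟩ : ∃ a b, a < b ∧ f a = f b := by
    obtain ⟨a, b, hab, hf⟩ := Finite.exists_ne_map_eq_of_infinite f
    rcases lt_or_gt_of_ne hab with h | h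
    · exact ⟨a, b, h, hf⟩
    · exact ⟨b, a, h, hf.symm⟩
  refine ⟨b - a, a, by omega, fun n hn => ?_⟩
  induction n, hn using Nat.le_induction with
  | base => rw [hf]; congr 1; omega
  | succ n hn ih => rw [show n + 1 + (b - a) = n + (b - a) + 1 by omega, h, h, ih]

theorem EvPeriodic.comp {α β : Type*} {f : ℕ → α} (h : EvPeriodic f) (φ : α → β) :
    EvPeriodic (fun n => φ (f n)) := by
  obtain ⟨p, N, hp, h⟩ := h
  exact ⟨p, N, hp, fun n hn => congrArg φ (h n hn)⟩

theorem EvPeriodic.of_forall_eq_imp {α β : Type*} {f : ℕ → α} {f' : ℕ → β} (h : EvPeriodic f)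
    (hf : ∀ i j, f i = f j → f' i = f' j) : EvPeriodic f' := by
  obtain ⟨p, N, hp, h⟩ := h
  exact ⟨p, N, hp, fun n hn => hf _ _ (h n hn)⟩

/-- The set of suffixes of an eventually periodic sequence is finite. -/
theorem EvPeriodic.finite_suffixes {α : Type*} {f : ℕ → α} (h : EvPeriodic f) :
    (Set.range fun k i : ℕ => f (k + i)).Finite := by
  obtain ⟨p, N, hp, h⟩ := h
  refine ((Set.finite_Iio (N + p)).image fun k i : ℕ => f (k + i)).subset ?_
  rintro _ ⟨k, rfl⟩
  induction k using Nat.strong_induction_on with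
  | _ k ih =>
    by_cases hk : k < N + p
    · exact ⟨k, hk, rfl⟩
    · obtain ⟨k', hk', e⟩ := ih (k - p) (by omega)
      refine ⟨k', hk', e.trans (funext fun i => ?_)⟩
      change f (k - p + i) = f (k + i)
      rw [← h _ (by omega)]
      congr 1
      omega

/-- The values at position `k` of the points of a sofic shift constrained at the origin are
eventually periodic in `k`. -/
theorem IsGraphSofic.evPeriodic_image {α : Type*} {X : Set (ℤ → α)} (h : IsGraphSofic X)
    (P : Set α) : EvPeriodic fun k : ℕ => (fun x : ℤ → α => x k) '' {x ∈ X | x 0 ∈ P} := by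
  obtain ⟨T, hT, E, l, rfl⟩ := h
  let R : ℕ → Set T := fun k =>
    {t | ∃ y : ℤ → T, (∀ i, E (y i) (y (i + 1))) ∧ l (y 0) ∈ P ∧ y k = t}
  have hR : EvPeriodic R := by
    refine evPeriodic_of_succ_eq
      (fun A => {t | ∃ y : ℤ → T, (∀ i, E (y i) (y (i + 1))) ∧ y 0 ∈ A ∧ y 1 = t}) fun k => ?_
    ext t
    constructor
    · rintro ⟨y, hy, h0, rfl⟩
      refine ⟨fun i => y (i + k), fun i => ?_, ⟨y, hy, h0, by simp⟩, ?_⟩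
      · have := hy (i + k)
        rwa [show i + k + 1 = i + 1 + k by ring] at this
      · simp [add_comm]
    · rintro ⟨y, hy, ⟨y', hy', h0, h1⟩, rfl⟩
      refine ⟨fun i => if i ≤ k then y' i else y (i - k), fun i => ?_, ?_, ?_⟩
      · rcases lt_trichotomy i k with hi | hi | hi
        · simpa [hi.le, show i + 1 ≤ k by omega] using hy' i
        · subst hi
          have := hy 0
          simp only [le_refl, if_true, show ¬ ((k : ℤ) + 1 ≤ k) by omega, if_false, h1]
          convert this using 2
          ring
        · simp only [show ¬ (i ≤ k) by omega, show ¬ (i + 1 ≤ k) by omega, if_false]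
          have := hy (i - k)
          rwa [show i - k + 1 = i + 1 - k by ring] at this
      · simpa using h0
      · simp
  convert hR.comp (fun A => l '' A) using 1
  funext k
  ext s
  constructor
  · rintro ⟨x, ⟨⟨y, hy, hx⟩, h0⟩, rfl⟩
    exact ⟨y k, ⟨y, hy, by rwa [hx], rfl⟩, hx k⟩
  · rintro ⟨_, ⟨y, hy, h0, rfl⟩, rfl⟩
    exact ⟨fun i => l (y i), ⟨⟨y, hy, fun _ => rfl⟩, h0⟩, rfl⟩

theorem IsGraphSofic.evPeriodicBoth {α : Type*} {X : Set (ℤ → α)} (h : IsGraphSofic X)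
    (P : Set α) (z : ℤ → α)
    (hz : ∀ i j, (fun x : ℤ → α => x i) '' {x ∈ X | x 0 ∈ P} =
      (fun x : ℤ → α => x j) '' {x ∈ X | x 0 ∈ P} → z i = z j) : EvPeriodicBoth z := by
  rw [evPeriodicBoth_iff]
  refine ⟨(h.evPeriodic_image P).of_forall_eq_imp fun i j => hz i j,
    (h.reflect.evPeriodic_image P).of_forall_eq_imp fun i j hij => hz _ _ ?_⟩
  have key : ∀ k : ℕ, (fun x : ℤ → α => x k) '' {x ∈ {x | (fun i => x (-i)) ∈ X} | x 0 ∈ P} =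
      (fun x : ℤ → α => x (-k)) '' {x ∈ X | x 0 ∈ P} := by
    intro k
    ext s
    constructor
    · rintro ⟨x, ⟨hx, h0⟩, rfl⟩
      exact ⟨fun i => x (-i), ⟨hx, by simpa using h0⟩, by simp⟩
    · rintro ⟨x, ⟨hx, h0⟩, rfl⟩
      exact ⟨fun i => x (-i), ⟨by simpa using hx, by simpa using h0⟩, rfl⟩
  rwa [key, key] at hij

/-- The lower bounds that each cell imposes on the cells to its right define a sofic shift
when these bounds are eventually periodic. -/
theorem isGraphSofic_of_evPeriodic {S : Type*} [Finite S] [LE S] (f : S → ℕ → S)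
    (hf : ∀ a, EvPeriodic (f a)) :
    IsGraphSofic {x : ℤ → S | ∀ (j : ℤ) (k : ℕ), f (x j) k ≤ x (j + k)} := by
  let Q : Set (ℕ → S) := ⋃ a, Set.range fun k i : ℕ => f a (k + i)
  have hQ : Finite Q := (Set.finite_iUnion fun a => (hf a).finite_suffixes).to_subtype
  convert isGraphSofic_of_finite (T := S × Set Q)
    (fun s t => (∀ q ∈ s.2, ∃ q' ∈ t.2, q'.1 = fun i => q.1 (i + 1)) ∧
      (∃ q ∈ s.2, q.1 = f s.1) ∧ ∀ q ∈ s.2, q.1 0 ≤ s.1)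
    (fun s => s.1) using 1
  ext x
  constructor
  · intro hx
    have hmem : ∀ (a : S) (k : ℕ), (fun i => f a (k + i)) ∈ Q := fun a k =>
      Set.mem_iUnion.2 ⟨a, k, rfl⟩
    refine ⟨fun j => (x j, {q | ∃ k : ℕ, q.1 = fun i => f (x (j - k)) (k + i)}), fun j =>
      ⟨?_, ?_, ?_⟩, fun j => rfl⟩
    · rintro q ⟨k, hk⟩
      refine ⟨⟨_, hmem (x (j - k)) (k + 1)⟩, ⟨k + 1, ?_⟩, ?_⟩
      · simp
      · funext i
        rw [hk]
        ring_nf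
    · exact ⟨⟨_, hmem (x j) 0⟩, ⟨0, by simp⟩, by simp⟩
    · rintro q ⟨k, hk⟩
      simpa [hk] using hx (j - k) k
  · rintro ⟨y, hy, hx⟩ j k
    have key : ∀ k : ℕ, ∃ q ∈ (y (j + k)).2, q.1 = fun i => f (x j) (k + i) := by
      intro k
      induction k with
      | zero =>
        obtain ⟨q, hq, e⟩ := (hy j).2.1
        exact ⟨q, by simpa using hq, by simp [e, hx j]⟩
      | succ k ih =>
        obtain ⟨q, hq, e⟩ := ih
        obtain ⟨q', hq', e'⟩ := (hy (j + k)).1 q hq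
        refine ⟨q', by simpa [add_assoc] using hq', ?_⟩
        rw [e', e]
        funext i
        ring_nf
    obtain ⟨q, hq, e⟩ := key k
    have := (hy (j + k)).2.2 q hq
    rw [e, hx] at this
    simpa using this

theorem IsSubshift.shift_mem {α : Type*} {X : Set (ℤ → α)} (hX : IsSubshift X) (k : ℤ) :
    ∀ x ∈ X, (fun i => x (i + k)) ∈ X := by
  induction k using Int.induction_on with
  | zero => intro x hx; simpa using hx
  | succ k ih =>
    intro x hx
    convert hX.1 _ (ih x hx) using 1
    funext i
    simp only [shiftMap]
    congr 1
    ring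
  | pred k ih =>
    intro x hx
    obtain ⟨y, hy, rfl⟩ := hX.2.1 x hx
    convert ih y hy using 1
    funext i
    simp only [shiftMap]
    congr 1
    ring

section LatticeSubshift

variable {S : Type*} [Finite S] [Lattice S] {X : Set (ℤ → S)} {m : S → ℤ → S}

theorem minConfig_mem (hX : IsSubshift X) (hB1 : ∀ a : S, ∃ x ∈ X, x 0 = a)
    (hinf : ∀ x ∈ X, ∀ y ∈ X, (fun i => x i ⊓ y i) ∈ X)
    (hm : ∀ (a : S) (i : ℤ), IsGLB ((fun x : ℤ → S => x i) '' {x ∈ X | a ≤ x 0}) (m a i))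
    (a : S) : m a ∈ X := by
  have attained : ∀ i, ∃ y ∈ X, a ≤ y 0 ∧ y i = m a i := by
    intro i
    obtain ⟨x, hx, h0⟩ := hB1 a
    obtain ⟨b, ⟨y, ⟨hy, hy0⟩, rfl⟩, hmin⟩ :=
      (Set.toFinite ((fun x : ℤ → S => x i) '' {x ∈ X | a ≤ x 0})).exists_minimal
        ⟨_, x, ⟨hx, h0.ge⟩, rfl⟩
    have hleast : IsLeast ((fun x : ℤ → S => x i) '' {x ∈ X | a ≤ x 0}) (y i) := by
      refine ⟨⟨y, ⟨hy, hy0⟩, rfl⟩, ?_⟩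
      rintro _ ⟨z, ⟨hz, hz0⟩, rfl⟩
      have hyz : y i ⊓ z i ∈ (fun x : ℤ → S => x i) '' {x ∈ X | a ≤ x 0} :=
        ⟨_, ⟨hinf y hy z hz, le_inf hy0 hz0⟩, rfl⟩
      exact (hmin hyz inf_le_left).trans inf_le_right
    exact ⟨y, hy, hy0, hleast.isGLB.unique (hm a i)⟩
  have window : ∀ F : Finset ℤ, ∃ y ∈ X, a ≤ y 0 ∧ ∀ i ∈ F, y i = m a i := by
    intro F
    induction F using Finset.induction_on with
    | empty =>
      obtain ⟨x, hx, h0⟩ := hB1 a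
      exact ⟨x, hx, h0.ge, by simp⟩
    | insert j F _ ih =>
      obtain ⟨y, hy, hy0, h⟩ := ih
      obtain ⟨z, hz, hz0, h'⟩ := attained j
      refine ⟨_, hinf y hy z hz, le_inf hy0 hz0, fun i hi => ?_⟩
      rcases Finset.mem_insert.1 hi with rfl | hi
      · simp only [h', inf_eq_right]
        exact (hm a i).1 ⟨y, ⟨hy, hy0⟩, rfl⟩
      · simp only [h i hi, inf_eq_left]
        exact (hm a i).1 ⟨z, ⟨hz, hz0⟩, rfl⟩
  refine hX.2.2 _ fun n => ?_
  obtain ⟨y, hy, -, h⟩ := window (Finset.Icc (-n) n)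
  exact ⟨y, hy, fun i hi => h i (Finset.mem_Icc.2 (abs_le.1 hi))⟩

/-- A cellwise lattice subshift is defined by the lower bounds given by its minimal
configurations. -/
theorem mem_iff_minConfig_le (hX : IsSubshift X) (hB1 : ∀ a : S, ∃ x ∈ X, x 0 = a)
    (hinf : ∀ x ∈ X, ∀ y ∈ X, (fun i => x i ⊓ y i) ∈ X)
    (hsup : ∀ x ∈ X, ∀ y ∈ X, (fun i => x i ⊔ y i) ∈ X)
    (hm : ∀ (a : S) (i : ℤ), IsGLB ((fun x : ℤ → S => x i) '' {x ∈ X | a ≤ x 0}) (m a i))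
    (x : ℤ → S) : x ∈ X ↔ ∀ j k, m (x j) k ≤ x (j + k) := by
  constructor
  · intro hx j k
    exact (hm (x j) k).1 ⟨_, ⟨hX.shift_mem j x hx, by simp⟩, by simp [add_comm]⟩
  · intro hx
    have hmem : ∀ j, (fun i => m (x j) (i - j)) ∈ X := fun j =>
      hX.shift_mem (-j) _ (minConfig_mem hX hB1 hinf hm (x j))
    have hle : ∀ j i, m (x j) (i - j) ≤ x i := fun j i => by simpa using hx j (i - j)
    have hge : ∀ a, a ≤ m a 0 := by
      intro a
      refine (hm a 0).2 ?_
      rintro _ ⟨z, ⟨-, hz⟩, rfl⟩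
      exact hz
    have window : ∀ F : Finset ℤ, ∃ z ∈ X, (∀ i, z i ≤ x i) ∧ ∀ i ∈ F, x i ≤ z i := by
      intro F
      induction F using Finset.induction_on with
      | empty => exact ⟨_, hmem 0, hle 0, by simp⟩
      | insert j F _ ih =>
        obtain ⟨z, hz, h1, h2⟩ := ih
        refine ⟨_, hsup z hz _ (hmem j), fun i => sup_le (h1 i) (hle j i), fun i hi => ?_⟩
        rcases Finset.mem_insert.1 hi with rfl | hi
        · refine le_sup_of_le_right ?_
          simpa using hge (x i)
        · exact le_sup_of_le_left (h2 i hi)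
    refine hX.2.2 _ fun n => ?_
    obtain ⟨z, hz, h1, h2⟩ := window (Finset.Icc (-n) n)
    exact ⟨z, hz, fun i hi => (h1 i).antisymm (h2 i (Finset.mem_Icc.2 (abs_le.1 hi)))⟩

end LatticeSubshift

/-- A cellwise lattice subshift is sofic iff all the configurations `m^a` and `M^a`
are eventually periodic in both directions. -/
theorem stmt2 {S : Type*} [Fintype S] [Lattice S]
    (X : Set (ℤ → S)) (hX : IsSubshift X) (hne : X.Nonempty)
    (hB1 : ∀ a : S, ∃ x ∈ X, x 0 = a)
    (hops : ∀ x ∈ X, ∀ y ∈ X, (fun i => x i ⊓ y i) ∈ X ∧ (fun i => x i ⊔ y i) ∈ X)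
    (m M : S → ℤ → S)
    (hm : ∀ (a : S) (i : ℤ), IsGLB ((fun x : ℤ → S => x i) '' {x ∈ X | a ≤ x 0}) (m a i))
    (hM : ∀ (a : S) (i : ℤ), IsLUB ((fun x : ℤ → S => x i) '' {x ∈ X | x 0 ≤ a}) (M a i)) :
    IsSofic X ↔ ∀ a : S, EvPeriodicBoth (m a) ∧ EvPeriodicBoth (M a) := by
  constructor
  · intro h a
    refine ⟨h.isGraphSofic.evPeriodicBoth (Set.Ici a) _ fun i j hij => ?_,
      h.isGraphSofic.evPeriodicBoth (Set.Iic a) _ fun i j hij => ?_⟩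
    · exact IsGLB.unique (hm a i) (hij ▸ hm a j)
    · exact IsLUB.unique (hM a i) (hij ▸ hM a j)
  · intro h
    have hper := fun a => (evPeriodicBoth_iff (m a)).1 (h a).1
    have hright := isGraphSofic_of_evPeriodic (fun a k => m a k) fun a => (hper a).1
    have hleft := (isGraphSofic_of_evPeriodic (fun a k => m a (-k)) fun a => (hper a).2).reflect
    convert (hright.inter hleft).isSofic using 1
    ext x
    rw [mem_iff_minConfig_le hX hB1 (fun x hx y hy => (hops x hx y hy).1)
      (fun x hx y hy => (hops x hx y hy).2) hm]
    constructor
    · intro hx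
      refine ⟨fun j k => hx j k, fun j k => ?_⟩
      simpa [add_comm] using hx (-j) (-k)
    · rintro ⟨h1, h2⟩ j k
      obtain ⟨n, rfl | rfl⟩ := k.eq_nat_or_neg
      · exact h1 j n
      · simpa [add_comm] using h2 (-j) n
end

section
/- Let X ⊆ 𝟚^ℤ be a nonempty subshift with B_1(X) = 𝟚 (i.e., both symbols occur). Then X is closed under the cellwise operations ⊓ and ⊔ if and only if one of the following holds: (1) X = 𝟚^ℤ; (2) X = { x ∈ 𝟚^ℤ : σ^n(x) = x } for some n ≥ 1; (3) X = { x ∈ 𝟚^ℤ : ∀ i ∈ ℤ, ∀ p ∈ P, x_i = 1 → x_{i+p} = 1 } for some finite set P ⊆ ℕ; (4) X = { x ∈ 𝟚^ℤ : ∀ i ∈ ℤ, ∀ p ∈ P, x_i = 1 → x_{i-p} = 1 } for some finite set P ⊆ ℕ. -/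
/-- The points of `ℤ → Bool` whose support is stable under translation by elements of `M`. -/
def translationStable (M : Set ℤ) : Set (ℤ → Bool) :=
  {x | ∀ i, ∀ s ∈ M, x i = true → x (i + s) = true}

/-- The submonoid of all `s` such that every `x ∈ X` has support stable under translation
by `s`. -/
def stabilizingSubmonoid (X : Set (ℤ → Bool)) : AddSubmonoid ℤ where
  carrier := {s | ∀ x ∈ X, ∀ i, x i = true → x (i + s) = true}
  zero_mem' := by
    intro x _ i h
    simpa using h
  add_mem' := by
    intro s t hs ht x hx i h
    rw [← add_assoc]
    exact ht x hx _ (hs x hx i h)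

theorem mem_stabilizingSubmonoid {X : Set (ℤ → Bool)} {s : ℤ} :
    s ∈ stabilizingSubmonoid X ↔ ∀ x ∈ X, ∀ i, x i = true → x (i + s) = true :=
  Iff.rfl

theorem shiftMap_iterate {α : Type*} (n : ℕ) (x : ℤ → α) :
    shiftMap^[n] x = fun i => x (i + n) := by
  induction n generalizing x with
  | zero => simp
  | succ n ih =>
    rw [Function.iterate_succ_apply, ih]
    funext i
    simp only [shiftMap]
    congr 1
    push_cast
    ring

theorem IsSubshift.translate_mem {α : Type*} {X : Set (ℤ → α)} (hX : IsSubshift X) (k : ℤ)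
    {x : ℤ → α} (hx : x ∈ X) : (fun i => x (i + k)) ∈ X := by
  induction k with
  | zero => simpa using hx
  | succ k ih =>
    convert hX.1 _ ih using 1
    funext i
    simp only [shiftMap]
    congr 1
    ring
  | pred k ih =>
    obtain ⟨y, hy, hyx⟩ := hX.2.1 _ ih
    convert hy
    rename_i i
    have h := congrFun hyx (i - 1)
    simp only [shiftMap, sub_add_cancel] at h
    rw [h]
    congr 1
    ring

/-- If for any two coordinates some point of a lattice `X` dominates `x` at the first one and is
dominated by `x` at the second one, then `x` agrees with points of `X` on finite sets. -/
theorem exists_mem_eqOn_finset {ι : Type*} [Nonempty ι] {X : Set (ι → Bool)}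
    (hinf : ∀ x ∈ X, ∀ y ∈ X, (fun i => x i && y i) ∈ X)
    (hsup : ∀ x ∈ X, ∀ y ∈ X, (fun i => x i || y i) ∈ X) {x : ι → Bool}
    (hx : ∀ i j, ∃ y ∈ X, (x i = true → y i = true) ∧ (y j = true → x j = true))
    (F : Finset ι) : ∃ y ∈ X, ∀ i ∈ F, y i = x i := by
  classical
  have below (i : ι) (G : Finset ι) :
      ∃ y ∈ X, (x i = true → y i = true) ∧ ∀ j ∈ G, y j = true → x j = true := by
    induction G using Finset.induction_on with
    | empty =>
      obtain ⟨y, hy, h, -⟩ := hx i i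
      exact ⟨y, hy, h, by simp⟩
    | insert j G _ ih =>
      obtain ⟨y, hy, hyi, hyG⟩ := ih
      obtain ⟨z, hz, hzi, hzj⟩ := hx i j
      refine ⟨_, hinf y hy z hz, by simp_all, ?_⟩
      simp only [Finset.mem_insert, Bool.and_eq_true]
      rintro k (rfl | hk) ⟨h₁, h₂⟩
      · exact hzj h₂
      · exact hyG k hk h₁
  have between (G : Finset ι) :
      ∃ y ∈ X, (∀ i ∈ G, x i = true → y i = true) ∧ ∀ j ∈ F, y j = true → x j = true := by
    induction G using Finset.induction_on with
    | empty =>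
      obtain ⟨y, hy, -, h⟩ := below (Classical.arbitrary ι) F
      exact ⟨y, hy, by simp, h⟩
    | insert i G _ ih =>
      obtain ⟨y, hy, hyG, hyF⟩ := ih
      obtain ⟨z, hz, hzi, hzF⟩ := below i F
      refine ⟨_, hsup y hy z hz, ?_, ?_⟩
      · simp only [Finset.mem_insert, Bool.or_eq_true]
        rintro k (rfl | hk) h
        · exact Or.inr (hzi h)
        · exact Or.inl (hyG k hk h)
      · simp only [Bool.or_eq_true]
        rintro k hk (h | h)
        · exact hyF k hk h
        · exact hzF k hk h
  obtain ⟨y, hy, h₁, h₂⟩ := between F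
  exact ⟨y, hy, fun i hi => Bool.eq_iff_iff.2 ⟨h₂ i hi, h₁ i hi⟩⟩

theorem IsSubshift.eq_translationStable {X : Set (ℤ → Bool)} (hX : IsSubshift X)
    (hB1 : ∀ a : Bool, ∃ x ∈ X, x 0 = a)
    (hinf : ∀ x ∈ X, ∀ y ∈ X, (fun i => x i && y i) ∈ X)
    (hsup : ∀ x ∈ X, ∀ y ∈ X, (fun i => x i || y i) ∈ X) :
    X = translationStable (stabilizingSubmonoid X) := by
  refine Set.Subset.antisymm (fun x hx i s hs => hs x hx i) fun x hx => hX.2.2 x fun n => ?_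
  have symbol (a : Bool) (j : ℤ) : ∃ y ∈ X, y j = a := by
    obtain ⟨y, hy, h⟩ := hB1 a
    exact ⟨_, hX.translate_mem (-j) hy, by simpa using h⟩
  suffices h : ∀ i j, ∃ y ∈ X, (x i = true → y i = true) ∧ (y j = true → x j = true) by
    obtain ⟨y, hy, hyx⟩ := exists_mem_eqOn_finset hinf hsup h (Finset.Icc (-(n : ℤ)) n)
    exact ⟨y, hy, fun i hi => hyx i (Finset.mem_Icc.2 (abs_le.1 hi))⟩
  intro i j
  by_cases hj : x j = true
  · obtain ⟨y, hy, h⟩ := symbol true i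
    exact ⟨y, hy, fun _ => h, fun _ => hj⟩
  by_cases hi : x i = true
  · have hs : j - i ∉ stabilizingSubmonoid X := by
      intro hs
      apply hj
      simpa using hx i _ hs hi
    rw [mem_stabilizingSubmonoid] at hs
    push Not at hs
    obtain ⟨y, hy, k, hk, hk'⟩ := hs
    refine ⟨_, hX.translate_mem (k - i) hy, fun _ => by simpa using hk, fun h => ?_⟩
    refine absurd ?_ hk'
    convert h using 2
    ring
  · obtain ⟨y, hy, h⟩ := symbol false j
    exact ⟨y, hy, fun h => absurd h hi, fun h' => by simp [h] at h'⟩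

theorem exists_finset_translationStable (M : AddSubmonoid ℤ) (f : ℕ →+ ℤ)
    (hf : ∀ s ∈ M, ∃ n, f n = s) :
    ∃ P : Finset ℕ, translationStable M =
      {x | ∀ i : ℤ, ∀ p ∈ P, x i = true → x (i + f p) = true} := by
  obtain ⟨P, hP⟩ := Nat.addSubmonoid_fg (M.comap f)
  refine ⟨P, Set.ext fun x => ⟨fun hx i p hp => hx i _ ?_, fun hx i s hs => ?_⟩⟩
  · have : p ∈ M.comap f := hP ▸ AddSubmonoid.subset_closure hp
    exact this
  · obtain ⟨n, rfl⟩ := hf s hs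
    have hn : n ∈ AddSubmonoid.closure (P : Set ℕ) := hP ▸ hs
    induction hn using AddSubmonoid.closure_induction generalizing i with
    | mem p hp => exact hx i p hp
    | zero => simp
    | add m n hm hn ihm ihn =>
      rw [map_add, ← add_assoc]
      exact fun h => ihn _ (hP.le hn) (ihm i (hP.le hm) h)

theorem Int.neg_mem_of_pos_of_neg (M : AddSubmonoid ℤ) {a b : ℤ} (ha : a ∈ M) (ha0 : 0 < a)
    (hb : b ∈ M) (hb0 : b < 0) {s : ℤ} (hs : s ∈ M) : -s ∈ M := by
  have key {m k : ℤ} (hm : m ∈ M) (hk : 0 ≤ k) : k * m ∈ M := by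
    lift k to ℕ using hk
    simpa using M.nsmul_mem hm k
  rcases le_total 0 s with h | h
  · have := M.add_mem (key hb h) (key hs (k := -b - 1) (by omega))
    convert this using 1
    ring
  · have := M.add_mem (key ha (k := -s) (by omega)) (key hs (k := a - 1) (by omega))
    convert this using 1
    ring

theorem exists_translationStable_eq_periodic (M : AddSubmonoid ℤ) {a b : ℤ} (ha : a ∈ M)
    (ha0 : 0 < a) (hb : b ∈ M) (hb0 : b < 0) :
    ∃ n : ℕ, 0 < n ∧ translationStable M = {x | shiftMap^[n] x = x} := by
  let H : AddSubgroup ℤ := { M with neg_mem' := Int.neg_mem_of_pos_of_neg M ha ha0 hb hb0 }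
  obtain ⟨c, hc⟩ := Int.subgroup_cyclic H
  have hH (s : ℤ) : s ∈ M ↔ (c.natAbs : ℤ) ∣ s := by
    change s ∈ H ↔ _
    rw [hc, ← AddSubgroup.zmultiples_eq_closure, Int.mem_zmultiples_iff, Int.natAbs_dvd]
  refine ⟨c.natAbs, Nat.pos_of_ne_zero fun h => ?_, ?_⟩
  · rw [hH, h, Nat.cast_zero, zero_dvd_iff] at ha
    omega
  ext x
  rw [Set.mem_ofPred_eq, shiftMap_iterate]
  refine ⟨fun hx => funext fun i => Bool.eq_iff_iff.2 ⟨fun h => ?_, ?_⟩, fun hx i s hs => ?_⟩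
  · simpa using hx _ (-c.natAbs : ℤ) ((hH _).2 (by simp)) h
  · exact hx i _ ((hH _).2 dvd_rfl)
  · obtain ⟨k, rfl⟩ := (hH s).1 hs
    have hp : Function.Periodic x (c.natAbs : ℤ) := congrFun hx
    rw [mul_comm, ← smul_eq_mul, hp.zsmul k i]
    exact id

/-- Characterization of binary cellwise lattice subshifts: a nonempty subshift of the
binary full shift (with both symbols occurring) is closed under the cellwise lattice
operations (`&&` is the meet and `||` the join of the lattice `𝟚 = Bool`) iff it is
the full shift, the set of `n`-periodic points, or given by a rule `x_i = 1 → x_{i±p} = 1`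
for `p` in a finite set `P ⊆ ℕ`. -/
theorem stmt3 (X : Set (ℤ → Bool)) (hX : IsSubshift X) (hne : X.Nonempty)
    (hB1 : ∀ a : Bool, ∃ x ∈ X, x 0 = a) :
    (∀ x ∈ X, ∀ y ∈ X, (fun i => x i && y i) ∈ X ∧ (fun i => x i || y i) ∈ X) ↔
      (X = Set.univ ∨
        (∃ n : ℕ, 0 < n ∧ X = {x : ℤ → Bool | shiftMap^[n] x = x}) ∨
        (∃ P : Finset ℕ, X = {x : ℤ → Bool |
          ∀ i : ℤ, ∀ p ∈ P, x i = true → x (i + (p : ℤ)) = true}) ∨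
        (∃ P : Finset ℕ, X = {x : ℤ → Bool |
          ∀ i : ℤ, ∀ p ∈ P, x i = true → x (i - (p : ℤ)) = true})) := by
  constructor
  · intro h
    have hS := hX.eq_translationStable hB1 (fun x hx y hy => (h x hx y hy).1)
      fun x hx y hy => (h x hx y hy).2
    generalize stabilizingSubmonoid X = M at hS
    subst hS
    by_cases hneg : ∃ b ∈ M, b < 0
    · by_cases hpos : ∃ a ∈ M, 0 < a
      · obtain ⟨b, hb, hb0⟩ := hneg
        obtain ⟨a, ha, ha0⟩ := hpos
        exact Or.inr (Or.inl (exists_translationStable_eq_periodic M ha ha0 hb hb0))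
      · push Not at hpos
        obtain ⟨P, hP⟩ := exists_finset_translationStable M (-Nat.castAddMonoidHom ℤ)
          fun s hs => ⟨s.natAbs, by simp [abs_of_nonpos (hpos s hs)]⟩
        exact Or.inr (Or.inr (Or.inr ⟨P, by simpa [sub_eq_add_neg] using hP⟩))
    · push Not at hneg
      obtain ⟨P, hP⟩ := exists_finset_translationStable M (Nat.castAddMonoidHom ℤ)
        fun s hs => ⟨s.natAbs, by simp [abs_of_nonneg (hneg s hs)]⟩
      exact Or.inr (Or.inr (Or.inl ⟨P, by simpa using hP⟩))
  · rintro (rfl | ⟨n, -, rfl⟩ | ⟨P, rfl⟩ | ⟨P, rfl⟩) x hx y hy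
    · exact ⟨trivial, trivial⟩
    · simp only [Set.mem_ofPred_eq, shiftMap_iterate, funext_iff] at hx hy ⊢
      simp [hx, hy]
    all_goals
      simp only [Set.mem_ofPred_eq, Bool.and_eq_true, Bool.or_eq_true] at hx hy ⊢
      exact ⟨fun i p hp h => ⟨hx i p hp h.1, hy i p hp h.2⟩,
        fun i p hp h => h.imp (hx i p hp) (hy i p hp)⟩
end

section
/- Let T be a finite type, S = 2^T the Boolean algebra of subsets of T, and X ⊆ S^ℤ a nonempty subshift with B_1(X) = S that is closed under the cellwise Boolean operations (cellwise intersection, union and complement). Then X is simple: there exists R ⊆ T such that (1) for every t ∈ T, either π_t(X) = { x ∈ 𝟚^ℤ : σ^n(x) = x } for some n ≥ 1, or π_t(X) = 𝟚^ℤ; (2) for every t ∈ T there exist r ∈ R and k ∈ ℤ with π_t = σ^k ∘ π_r as functions on X; and (3) for every r ∈ R, every x ∈ π_r(X) and every y ∈ π_{R∖{r}}(X), there exists z ∈ X with π_r(z) = x and π_{R∖{r}}(z) = y. -/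
/-- The shift by an arbitrary integer `k` (for `k = 1` this is `shiftMap`, and for
`k : ℤ`, `shiftZ k = σ^k`). -/
def shiftZ {α : Type*} (k : ℤ) (x : ℤ → α) : ℤ → α := fun i => x (i + k)

/-- The projection `π_t : (2^T)^ℤ → 𝟚^ℤ`, `π_t(x)_i = 1` iff `t ∈ x_i`. -/
noncomputable def piT {T : Type*} (t : T) (x : ℤ → Set T) : ℤ → Bool :=
  fun i => @decide (t ∈ x i) (Classical.propDecidable _)

/-- Two cells are equivalent when every configuration in `X` has the same bit on both. -/
def CellEquiv {T : Type*} (X : Set (ℤ → Set T)) (p q : T × ℤ) : Prop :=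
  ∀ x ∈ X, p.1 ∈ x p.2 ↔ q.1 ∈ x q.2

namespace CellEquiv

variable {T : Type*} {X : Set (ℤ → Set T)} {p q r : T × ℤ}

theorem refl (p : T × ℤ) : CellEquiv X p p := fun _ _ => Iff.rfl

theorem symm (h : CellEquiv X p q) : CellEquiv X q p := fun x hx => (h x hx).symm

theorem trans (h : CellEquiv X p q) (h' : CellEquiv X q r) : CellEquiv X p r :=
  fun x hx => (h x hx).trans (h' x hx)

end CellEquiv

section

variable {T : Type*} {X : Set (ℤ → Set T)}

theorem piT_eq_true_iff {t : T} {x : ℤ → Set T} {i : ℤ} : piT t x i = true ↔ t ∈ x i := by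
  simp [piT]

theorem piT_eq_piT_iff {t s : T} {x y : ℤ → Set T} {i j : ℤ} :
    piT t x i = piT s y j ↔ (t ∈ x i ↔ s ∈ y j) := by
  rw [Bool.eq_iff_iff, piT_eq_true_iff, piT_eq_true_iff]

theorem iterate_shiftMap_apply {α : Type*} (n : ℕ) (x : ℤ → α) (i : ℤ) :
    shiftMap^[n] x i = x (i + n) := by
  induction n generalizing i with
  | zero => simp
  | succ n ih =>
    rw [Function.iterate_succ_apply', shiftMap, ih]
    push_cast
    congr 1
    ring

theorem IsSubshift.shiftZ_mem {α : Type*} {X : Set (ℤ → α)} (hX : IsSubshift X) (k : ℤ)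
    {x : ℤ → α} (hx : x ∈ X) : shiftZ k x ∈ X := by
  induction k with
  | zero =>
    convert hx using 1
    funext i
    simp [shiftZ]
  | succ k ih =>
    convert hX.1 _ ih using 1
    funext i
    simp only [shiftZ, shiftMap]
    congr 1
    ring
  | pred k ih =>
    obtain ⟨y, hy, hyx⟩ := hX.2.1 _ ih
    convert hy using 1
    funext i
    have h := congrFun hyx (i - 1)
    simp only [shiftZ, shiftMap, sub_add_cancel] at h ⊢
    rw [h]
    congr 1
    ring

theorem CellEquiv.shift (hX : IsSubshift X) {t s : T} {i j : ℤ}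
    (h : CellEquiv X (t, i) (s, j)) (k : ℤ) : CellEquiv X (t, i + k) (s, j + k) :=
  fun _ hx => h _ (hX.shiftZ_mem k hx)

/-- Non-equivalent finite sets of cells are separated by a configuration. -/
theorem exists_mem_separating (hne : X.Nonempty)
    (hops : ∀ x ∈ X, ∀ y ∈ X, (fun i => x i ∩ y i) ∈ X ∧ (fun i => x i ∪ y i) ∈ X)
    (hcompl : ∀ x ∈ X, (fun i => (x i)ᶜ) ∈ X) (A B : Finset (T × ℤ))
    (hAB : ∀ p ∈ A, ∀ q ∈ B, ¬ CellEquiv X p q) :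
    ∃ y ∈ X, (∀ p ∈ A, p.1 ∈ y p.2) ∧ ∀ q ∈ B, q.1 ∉ y q.2 := by
  classical
  obtain ⟨x, hx⟩ := hne
  have separate_one : ∀ p : T × ℤ, ∀ B : Finset (T × ℤ), (∀ q ∈ B, ¬ CellEquiv X p q) →
      ∃ y ∈ X, p.1 ∈ y p.2 ∧ ∀ q ∈ B, q.1 ∉ y q.2 := by
    intro p B hB
    induction B using Finset.induction_on with
    | empty => exact ⟨_, (hops x hx _ (hcompl x hx)).2, by simp, by simp⟩
    | insert b B _ ih =>
      obtain ⟨y, hy, hyp, hyB⟩ := ih fun q hq => hB q (Finset.mem_insert_of_mem hq)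
      have hb := hB b (Finset.mem_insert_self b B)
      obtain ⟨w, hw, hwp, hwb⟩ : ∃ w ∈ X, p.1 ∈ w p.2 ∧ b.1 ∉ w b.2 := by
        simp only [CellEquiv, not_forall] at hb
        obtain ⟨w, hw, hwpb⟩ := hb
        by_cases hwp : p.1 ∈ w p.2
        · exact ⟨w, hw, hwp, by tauto⟩
        · refine ⟨_, hcompl w hw, hwp, ?_⟩
          simp only [Set.mem_compl_iff]
          tauto
      refine ⟨_, (hops y hy w hw).1, ⟨hyp, hwp⟩, fun q hq hqy => ?_⟩
      rcases Finset.mem_insert.1 hq with rfl | hq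
      · exact hwb hqy.2
      · exact hyB q hq hqy.1
  induction A using Finset.induction_on with
  | empty => exact ⟨_, (hops x hx _ (hcompl x hx)).1, by simp, by simp⟩
  | insert a A _ ih =>
    obtain ⟨y, hy, hyA, hyB⟩ := ih fun p hp => hAB p (Finset.mem_insert_of_mem hp)
    obtain ⟨w, hw, hwa, hwB⟩ := separate_one a B (hAB a (Finset.mem_insert_self a A))
    refine ⟨_, (hops y hy w hw).2, fun p hp => ?_, fun q hq hqy => ?_⟩
    · rcases Finset.mem_insert.1 hp with rfl | hp
      · exact Or.inr hwa
      · exact Or.inl (hyA p hp)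
    · exact hqy.elim (hyB q hq) (hwB q hq)

/-- A Boolean-closed subshift contains every configuration constant on the classes of
equivalent cells. -/
theorem mem_of_cellEquiv_invariant [Finite T] (hX : IsSubshift X) (hne : X.Nonempty)
    (hops : ∀ x ∈ X, ∀ y ∈ X, (fun i => x i ∩ y i) ∈ X ∧ (fun i => x i ∪ y i) ∈ X)
    (hcompl : ∀ x ∈ X, (fun i => (x i)ᶜ) ∈ X) {f : ℤ → Set T}
    (hf : ∀ p q, CellEquiv X p q → p.1 ∈ f p.2 → q.1 ∈ f q.2) : f ∈ X := by
  classical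
  have := Fintype.ofFinite T
  refine hX.2.2 f fun n => ?_
  let F : Finset (T × ℤ) := Finset.univ ×ˢ Finset.Icc (-(n : ℤ)) n
  obtain ⟨y, hy, hyA, hyB⟩ := exists_mem_separating hne hops hcompl
    (F.filter fun p => p.1 ∈ f p.2) (F.filter fun p => p.1 ∉ f p.2)
    fun p hp q hq h =>
      (Finset.mem_filter.1 hq).2 (hf p q h (Finset.mem_filter.1 hp).2)
  refine ⟨y, hy, fun i hi => Set.ext fun t => ?_⟩
  have hF : (t, i) ∈ F := by simpa [F] using abs_le.1 hi
  by_cases ht : t ∈ f i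
  · exact iff_of_true (hyA (t, i) (Finset.mem_filter.2 ⟨hF, ht⟩)) ht
  · exact iff_of_false (hyB (t, i) (Finset.mem_filter.2 ⟨hF, ht⟩)) ht

theorem mem_image_piT_of_invariant [Finite T] (hX : IsSubshift X) (hne : X.Nonempty)
    (hops : ∀ x ∈ X, ∀ y ∈ X, (fun i => x i ∩ y i) ∈ X ∧ (fun i => x i ∪ y i) ∈ X)
    (hcompl : ∀ x ∈ X, (fun i => (x i)ᶜ) ∈ X) {t : T} {z : ℤ → Bool}
    (hz : ∀ i j, CellEquiv X (t, i) (t, j) → z i = z j) : z ∈ piT t '' X := by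
  refine ⟨fun i => {s | ∃ j, CellEquiv X (s, i) (t, j) ∧ z j = true},
    mem_of_cellEquiv_invariant hX hne hops hcompl ?_, ?_⟩
  · rintro p q hpq ⟨j, hj, hzj⟩
    exact ⟨j, hpq.symm.trans hj, hzj⟩
  · funext i
    rw [Bool.eq_iff_iff, piT_eq_true_iff]
    exact ⟨fun ⟨j, hj, hzj⟩ => (hz i j hj).trans hzj, fun hi => ⟨i, .refl _, hi⟩⟩

/-- The common periods of the `t`-th coordinates of the configurations in `X`. -/
def periodSubgroup (hX : IsSubshift X) (t : T) : AddSubgroup ℤ where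
  carrier := {k | CellEquiv X (t, 0) (t, k)}
  zero_mem' := .refl _
  add_mem' {a b} ha hb := by
    have h := CellEquiv.shift hX ha b
    rw [zero_add] at h
    exact CellEquiv.trans hb h
  neg_mem' {a} ha := by
    have h := CellEquiv.shift hX ha (-a)
    rw [zero_add, add_neg_cancel] at h
    exact h.symm

theorem cellEquiv_iff_sub_mem_periodSubgroup (hX : IsSubshift X) {t : T} {i j : ℤ} :
    CellEquiv X (t, i) (t, j) ↔ j - i ∈ periodSubgroup hX t := by
  refine ⟨fun h => ?_, fun h => ?_⟩
  · have h' := h.shift hX (-i)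
    rw [add_neg_cancel, ← sub_eq_add_neg] at h'
    exact h'
  · have h' := CellEquiv.shift hX (show CellEquiv X (t, 0) (t, j - i) from h) i
    rwa [zero_add, sub_add_cancel] at h'

theorem image_piT_eq_periodic_or_univ [Finite T] (hX : IsSubshift X) (hne : X.Nonempty)
    (hops : ∀ x ∈ X, ∀ y ∈ X, (fun i => x i ∩ y i) ∈ X ∧ (fun i => x i ∪ y i) ∈ X)
    (hcompl : ∀ x ∈ X, (fun i => (x i)ᶜ) ∈ X) (t : T) :
    (∃ n : ℕ, 0 < n ∧ piT t '' X = {x : ℤ → Bool | shiftMap^[n] x = x}) ∨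
      piT t '' X = Set.univ := by
  obtain ⟨a, ha⟩ := Int.subgroup_cyclic (periodSubgroup hX t)
  have hmem : ∀ i j : ℤ, CellEquiv X (t, i) (t, j) ↔ (a.natAbs : ℤ) ∣ j - i := by
    intro i j
    rw [cellEquiv_iff_sub_mem_periodSubgroup hX, ha, ← AddSubgroup.zmultiples_eq_closure,
      Int.mem_zmultiples_iff, Int.natAbs_dvd]
  rcases Nat.eq_zero_or_pos a.natAbs with h0 | hpos
  · refine Or.inr (Set.eq_univ_of_forall fun z =>
      mem_image_piT_of_invariant hX hne hops hcompl fun i j hij => ?_)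
    rw [hmem, h0, Nat.cast_zero, zero_dvd_iff, sub_eq_zero] at hij
    rw [hij]
  · refine Or.inl ⟨a.natAbs, hpos, Set.Subset.antisymm ?_ fun z hz =>
      mem_image_piT_of_invariant hX hne hops hcompl fun i j hij => ?_⟩
    · rintro _ ⟨x, hx, rfl⟩
      funext i
      rw [iterate_shiftMap_apply, piT_eq_piT_iff]
      exact ((hmem i (i + a.natAbs)).2 (by simp) x hx).symm
    · have hper : Function.Periodic z (a.natAbs : ℤ) := fun i => by
        rw [← iterate_shiftMap_apply a.natAbs z i, show shiftMap^[a.natAbs] z = z from hz]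
      obtain ⟨c, hc⟩ := (hmem i j).1 hij
      rw [← hper.int_mul c i, Int.cast_id, mul_comm, ← hc, add_sub_cancel]

/-- Coordinates are related when they agree on `X` up to a fixed shift. -/
def shiftSetoid (hX : IsSubshift X) : Setoid T where
  r t s := ∃ k : ℤ, CellEquiv X (t, 0) (s, k)
  iseqv :=
    { refl := fun _ => ⟨0, .refl _⟩
      symm := fun ⟨k, h⟩ => ⟨-k, by simpa using (h.shift hX (-k)).symm⟩
      trans := fun ⟨k, h⟩ ⟨l, h'⟩ => ⟨l + k, h.trans (by simpa using h'.shift hX k)⟩ }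

end

/-- Theorem: a nonempty subshift over the Boolean algebra `2^T` with full one-letter
language, closed under the cellwise Boolean operations, is simple. -/
theorem stmt6 {T : Type*} [Fintype T]
    (X : Set (ℤ → Set T)) (hX : IsSubshift X) (hne : X.Nonempty)
    (hB1 : ∀ a : Set T, ∃ x ∈ X, x 0 = a)
    (hops : ∀ x ∈ X, ∀ y ∈ X, (fun i => x i ∩ y i) ∈ X ∧ (fun i => x i ∪ y i) ∈ X)
    (hcompl : ∀ x ∈ X, (fun i => (x i)ᶜ) ∈ X) :
    ∃ R : Set T,
      (∀ t : T,
        (∃ n : ℕ, 0 < n ∧ piT t '' X = {x : ℤ → Bool | shiftMap^[n] x = x}) ∨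
        piT t '' X = Set.univ) ∧
      (∀ t : T, ∃ r ∈ R, ∃ k : ℤ, ∀ x ∈ X, piT t x = shiftZ k (piT r x)) ∧
      (∀ r ∈ R, ∀ x ∈ X, ∀ y ∈ X, ∃ z ∈ X,
        piT r z = piT r x ∧ ∀ t ∈ R, t ≠ r → piT t z = piT t y) := by
  let _ := shiftSetoid hX
  refine ⟨Set.range (Quotient.out : Quotient (shiftSetoid hX) → T),
    image_piT_eq_periodic_or_univ hX hne hops hcompl, fun t => ?_, ?_⟩
  · obtain ⟨k, hk⟩ : ∃ k : ℤ, CellEquiv X (t, 0) ((⟦t⟧ : Quotient (shiftSetoid hX)).out, k) :=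
      Setoid.symm (Quotient.mk_out t)
    refine ⟨_, ⟨⟦t⟧, rfl⟩, k, fun x hx => funext fun i => ?_⟩
    have h := hk.shift hX i x hx
    rw [shiftZ, piT_eq_piT_iff, add_comm i k]
    simpa using h
  · rintro _ ⟨c, rfl⟩ x hx y hy
    let inOrbit (p : T × ℤ) : Prop := ∃ i, CellEquiv X p (c.out, i)
    refine ⟨fun i => {s | inOrbit (s, i) ∧ s ∈ x i ∨ ¬ inOrbit (s, i) ∧ s ∈ y i},
      mem_of_cellEquiv_invariant hX hne hops hcompl ?_, ?_, ?_⟩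
    · intro p q hpq hp
      have horbit : inOrbit p ↔ inOrbit q :=
        ⟨fun ⟨i, hi⟩ => ⟨i, hpq.symm.trans hi⟩, fun ⟨i, hi⟩ => ⟨i, hpq.trans hi⟩⟩
      simpa [horbit, hpq x hx, hpq y hy] using hp
    · funext i
      have horbit : inOrbit (c.out, i) := ⟨i, .refl _⟩
      simp [piT_eq_piT_iff, horbit]
    · rintro _ ⟨d, rfl⟩ hdc
      funext i
      have horbit : ¬ inOrbit (d.out, i) := by
        rintro ⟨j, hj⟩
        have hrel : d.out ≈ c.out := ⟨j - i, by
          simpa [sub_eq_add_neg] using hj.shift hX (-i)⟩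
        exact hdc (congrArg Quotient.out (Quotient.out_equiv_out.1 hrel))
      simp [piT_eq_piT_iff, horbit]
end

section
/- Let S be a finite type and X ⊆ S^ℤ a lattice subshift (a subshift equipped with lattice operations ⊓, ⊔ : X × X → X that are block maps). Then the following are equivalent: (a) there exist a finite lattice S', a subshift Y ⊆ S'^ℤ closed under the cellwise operations of S', and an algebraic conjugacy φ : X → Y; (b) there exists r ∈ ℕ such that every affine map of X has radius at most r. -/
/-- A map `F` out of a subshift `X` has radius at most `r`: `F x i` only depends on the
window `x_{[i-r,i+r]}`. -/
def HasRadius1 {α β : Type*} (X : Set (ℤ → α)) (F : (ℤ → α) → ℤ → β) (r : ℕ) : Prop :=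
  ∀ x ∈ X, ∀ y ∈ X, ∀ i : ℤ, (∀ j : ℤ, |j - i| ≤ (r : ℤ) → x j = y j) → F x i = F y i

/-- A binary operation on subshifts has radius at most `r`. -/
def HasRadius2 {α β γ : Type*} (X : Set (ℤ → α)) (Y : Set (ℤ → β))
    (F : (ℤ → α) → (ℤ → β) → ℤ → γ) (r : ℕ) : Prop :=
  ∀ x ∈ X, ∀ x' ∈ X, ∀ y ∈ Y, ∀ y' ∈ Y, ∀ i : ℤ,
    (∀ j : ℤ, |j - i| ≤ (r : ℤ) → x j = x' j ∧ y j = y' j) → F x y i = F x' y' i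

/-- `X` is a lattice subshift with meet `m` and join `j` (only the values of `m` and `j`
on `X` are relevant): the operations map `X` to `X`, satisfy the lattice identities on
`X`, and are block maps (finite radius and shift-equivariant). -/
structure IsLatticeSubshift {S : Type*} (X : Set (ℤ → S))
    (m j : (ℤ → S) → (ℤ → S) → (ℤ → S)) : Prop where
  subshift : IsSubshift X
  meet_mem : ∀ x ∈ X, ∀ y ∈ X, m x y ∈ X
  join_mem : ∀ x ∈ X, ∀ y ∈ X, j x y ∈ X
  meet_comm : ∀ x ∈ X, ∀ y ∈ X, m x y = m y x
  join_comm : ∀ x ∈ X, ∀ y ∈ X, j x y = j y x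
  meet_assoc : ∀ x ∈ X, ∀ y ∈ X, ∀ z ∈ X, m (m x y) z = m x (m y z)
  join_assoc : ∀ x ∈ X, ∀ y ∈ X, ∀ z ∈ X, j (j x y) z = j x (j y z)
  absorb_meet : ∀ x ∈ X, ∀ y ∈ X, m x (j x y) = x
  absorb_join : ∀ x ∈ X, ∀ y ∈ X, j x (m x y) = x
  meet_radius : ∃ r : ℕ, HasRadius2 X X m r
  join_radius : ∃ r : ℕ, HasRadius2 X X j r
  meet_shift : ∀ x ∈ X, ∀ y ∈ X, shiftMap (m x y) = m (shiftMap x) (shiftMap y)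
  join_shift : ∀ x ∈ X, ∀ y ∈ X, shiftMap (j x y) = j (shiftMap x) (shiftMap y)

/-- The affine maps of the lattice subshift `(X, m, j)`: the smallest collection of maps
containing the identity and the constants (with value in `X`) and closed under meeting
and joining with a constant. -/
inductive IsAffine {S : Type*} (X : Set (ℤ → S))
    (m j : (ℤ → S) → (ℤ → S) → (ℤ → S)) : ((ℤ → S) → (ℤ → S)) → Prop
  | id : IsAffine X m j (fun x => x)
  | const (c : ℤ → S) (hc : c ∈ X) : IsAffine X m j (fun _ => c)
  | meet (t : (ℤ → S) → (ℤ → S)) (c : ℤ → S) (hc : c ∈ X) (ht : IsAffine X m j t) :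
      IsAffine X m j (fun x => m (t x) c)
  | join (t : (ℤ → S) → (ℤ → S)) (c : ℤ → S) (hc : c ∈ X) (ht : IsAffine X m j t) :
      IsAffine X m j (fun x => j (t x) c)

/-- `(X, m, j)` is algebraically conjugate (via `φ`, with inverse `ψ`, both block maps)
to the subshift `Y` over the finite lattice `S'`, which is closed under the cellwise
lattice operations of `S'`. -/
def ConjugacyData {S : Type*} (X : Set (ℤ → S)) (m j : (ℤ → S) → (ℤ → S) → (ℤ → S))
    {S' : Type} [Lattice S'] (Y : Set (ℤ → S')) : Prop :=
  IsSubshift Y ∧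
  (∀ y ∈ Y, ∀ z ∈ Y, (fun i => y i ⊓ z i) ∈ Y ∧ (fun i => y i ⊔ z i) ∈ Y) ∧
  ∃ (φ : (ℤ → S) → (ℤ → S')) (ψ : (ℤ → S') → (ℤ → S)),
    Set.BijOn φ X Y ∧ (∀ x ∈ X, ψ (φ x) = x) ∧
    (∃ r : ℕ, HasRadius1 X φ r) ∧ (∃ r : ℕ, HasRadius1 Y ψ r) ∧
    (∀ x ∈ X, φ (shiftMap x) = shiftMap (φ x)) ∧
    (∀ x ∈ X, ∀ y ∈ X, φ (m x y) = fun i => φ x i ⊓ φ y i) ∧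
    (∀ x ∈ X, ∀ y ∈ X, φ (j x y) = fun i => φ x i ⊔ φ y i)

/-- `(X, m, j)` is, up to algebraic conjugacy, a cellwise lattice subshift over some
finite lattice. -/
def AlgConjToCellwise {S : Type*} (X : Set (ℤ → S))
    (m j : (ℤ → S) → (ℤ → S) → (ℤ → S)) : Prop :=
  ∃ (S' : Type) (_ : Fintype S') (iL : Lattice S') (Y : Set (ℤ → S')),
    @ConjugacyData S X m j S' iL Y

/-- The `n`-th power of the shift map. -/
def shiftBy {α : Type*} (n : ℤ) (x : ℤ → α) : ℤ → α := fun i => x (i + n)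

theorem shiftMap_injective {α : Type*} :
    Function.Injective (shiftMap : (ℤ → α) → ℤ → α) := by
  intro x y h
  funext i
  simpa [shiftMap] using congrFun h (i - 1)

theorem shiftBy_zero {α : Type*} (x : ℤ → α) : shiftBy 0 x = x := by
  funext i
  simp [shiftBy]

theorem shiftBy_add_one {α : Type*} (n : ℤ) (x : ℤ → α) :
    shiftBy (n + 1) x = shiftMap (shiftBy n x) := by
  funext i
  simp only [shiftBy, shiftMap]
  congr 1
  ring

theorem shiftBy_shiftMap {α : Type*} (n : ℤ) (x : ℤ → α) :
    shiftBy n (shiftMap x) = shiftBy (n + 1) x := by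
  funext i
  simp only [shiftBy, shiftMap]
  congr 1
  ring

theorem shiftMap_shiftBy_sub_one {α : Type*} (n : ℤ) (x : ℤ → α) :
    shiftMap (shiftBy (n - 1) x) = shiftBy n x := by
  rw [← shiftBy_add_one, sub_add_cancel]

theorem IsSubshift.mem_of_shiftMap_mem {α : Type*} {X : Set (ℤ → α)} (hX : IsSubshift X)
    {x : ℤ → α} (hx : shiftMap x ∈ X) : x ∈ X := by
  obtain ⟨y, hy, hyx⟩ := hX.2.1 _ hx
  exact shiftMap_injective hyx ▸ hy

theorem IsSubshift.shiftBy_mem {α : Type*} {X : Set (ℤ → α)} (hX : IsSubshift X)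
    {x : ℤ → α} (hx : x ∈ X) (n : ℤ) : shiftBy n x ∈ X := by
  induction n using Int.induction_on with
  | zero => rwa [shiftBy_zero]
  | succ n ih => rw [shiftBy_add_one]; exact hX.1 _ ih
  | pred n ih => exact hX.mem_of_shiftMap_mem (by rwa [shiftMap_shiftBy_sub_one])

theorem IsSubshift.shiftBy_op {α : Type*} {X : Set (ℤ → α)} (hX : IsSubshift X)
    {F : (ℤ → α) → (ℤ → α) → ℤ → α}
    (hF : ∀ x ∈ X, ∀ y ∈ X, shiftMap (F x y) = F (shiftMap x) (shiftMap y))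
    {x y : ℤ → α} (hx : x ∈ X) (hy : y ∈ X) (n : ℤ) :
    shiftBy n (F x y) = F (shiftBy n x) (shiftBy n y) := by
  induction n using Int.induction_on with
  | zero => simp only [shiftBy_zero]
  | succ n ih =>
    simp only [shiftBy_add_one]
    rw [ih, hF _ (hX.shiftBy_mem hx _) _ (hX.shiftBy_mem hy _)]
  | pred n ih =>
    apply shiftMap_injective
    rw [shiftMap_shiftBy_sub_one, ih, hF _ (hX.shiftBy_mem hx _) _ (hX.shiftBy_mem hy _),
      shiftMap_shiftBy_sub_one, shiftMap_shiftBy_sub_one]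

namespace IsAffine

variable {S : Type*} {X : Set (ℤ → S)} {m j : (ℤ → S) → (ℤ → S) → (ℤ → S)}

theorem comp {s t : (ℤ → S) → ℤ → S} (ht : IsAffine X m j t) (hs : IsAffine X m j s) :
    IsAffine X m j (fun x => t (s x)) := by
  induction ht with
  | id => exact hs
  | const c hc => exact .const c hc
  | meet t c hc _ ih => exact .meet _ c hc ih
  | join t c hc _ ih => exact .join _ c hc ih

theorem mem (hL : IsLatticeSubshift X m j) {t : (ℤ → S) → ℤ → S}
    (ht : IsAffine X m j t) {x : ℤ → S} (hx : x ∈ X) : t x ∈ X := by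
  induction ht with
  | id => exact hx
  | const c hc => exact hc
  | meet t c hc _ ih => exact hL.meet_mem _ ih _ hc
  | join t c hc _ ih => exact hL.join_mem _ ih _ hc

/-- Under a homomorphism into a cellwise lattice, affine maps act cell by cell. -/
theorem apply_eq_of_apply_eq (hL : IsLatticeSubshift X m j) {S' : Type*} [Lattice S']
    {φ : (ℤ → S) → ℤ → S'}
    (hm : ∀ x ∈ X, ∀ y ∈ X, φ (m x y) = fun i => φ x i ⊓ φ y i)
    (hj : ∀ x ∈ X, ∀ y ∈ X, φ (j x y) = fun i => φ x i ⊔ φ y i)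
    {t : (ℤ → S) → ℤ → S} (ht : IsAffine X m j t) {x y : ℤ → S} (hx : x ∈ X) (hy : y ∈ X)
    {i : ℤ} (h : φ x i = φ y i) : φ (t x) i = φ (t y) i := by
  induction ht with
  | id => exact h
  | const c hc => rfl
  | meet t c hc ht ih => simp only [hm _ (ht.mem hL hx) _ hc, hm _ (ht.mem hL hy) _ hc, ih]
  | join t c hc ht ih => simp only [hj _ (ht.mem hL hx) _ hc, hj _ (ht.mem hL hy) _ hc, ih]

end IsAffine

theorem AlgConjToCellwise.exists_affine_radius {S : Type*} {X : Set (ℤ → S)}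
    {m j : (ℤ → S) → (ℤ → S) → (ℤ → S)} (hL : IsLatticeSubshift X m j)
    (h : AlgConjToCellwise X m j) :
    ∃ r : ℕ, ∀ t : (ℤ → S) → (ℤ → S), IsAffine X m j t → HasRadius1 X t r := by
  obtain ⟨S', _, _, Y, -, -, φ, ψ, hφ, hψφ, ⟨r, hr⟩, ⟨s, hs⟩, -, hm, hj⟩ := h
  refine ⟨r + s, fun t ht x hx y hy i hxy => ?_⟩
  rw [← hψφ _ (ht.mem hL hx), ← hψφ _ (ht.mem hL hy)]
  refine hs _ (hφ.mapsTo (ht.mem hL hx)) _ (hφ.mapsTo (ht.mem hL hy)) i fun k hk =>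
    ht.apply_eq_of_apply_eq hL hm hj hx hy (hr x hx y hy k fun l hl => hxy l ?_)
  rw [abs_le] at *
  push_cast
  omega

/-- Lattice operations descend along a surjection whose kernel is a congruence. -/
theorem exists_lattice_of_surjective {A T : Type*} {q : A → T} (hq : Function.Surjective q)
    (M J : A → A → A)
    (hM : ∀ x x' y y', q x = q x' → q y = q y' → q (M x y) = q (M x' y'))
    (hJ : ∀ x x' y y', q x = q x' → q y = q y' → q (J x y) = q (J x' y'))
    (M_comm : ∀ x y, M x y = M y x) (J_comm : ∀ x y, J x y = J y x)
    (M_assoc : ∀ x y z, M (M x y) z = M x (M y z))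
    (J_assoc : ∀ x y z, J (J x y) z = J x (J y z))
    (M_absorb : ∀ x y, M x (J x y) = x) (J_absorb : ∀ x y, J x (M x y) = x) :
    ∃ _ : Lattice T, (∀ x y, q (M x y) = q x ⊓ q y) ∧ ∀ x y, q (J x y) = q x ⊔ q y := by
  choose out hout using hq
  let iMin : Min T := ⟨fun a b => q (M (out a) (out b))⟩
  let iMax : Max T := ⟨fun a b => q (J (out a) (out b))⟩
  have hmin : ∀ x y, q x ⊓ q y = q (M x y) := fun x y => hM _ _ _ _ (hout _) (hout _)
  have hmax : ∀ x y, q x ⊔ q y = q (J x y) := fun x y => hJ _ _ _ _ (hout _) (hout _)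
  have hsurj : Function.Surjective q := fun a => ⟨out a, hout a⟩
  refine ⟨Lattice.mk' ?_ ?_ ?_ ?_ ?_ ?_, fun x y => (hmin x y).symm, fun x y => (hmax x y).symm⟩
  · exact hsurj.forall₂.2 fun x y => by rw [hmax, hmax, J_comm]
  · exact hsurj.forall₃.2 fun x y z => by simp only [hmax, J_assoc]
  · exact hsurj.forall₂.2 fun x y => by rw [hmin, hmin, M_comm]
  · exact hsurj.forall₃.2 fun x y z => by simp only [hmin, M_assoc]
  · exact hsurj.forall₂.2 fun x y => by rw [hmin, hmax, J_absorb]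
  · exact hsurj.forall₂.2 fun x y => by rw [hmax, hmin, M_absorb]

/-- Two points are related when no affine map separates them at the origin. -/
def affineSetoid {S : Type*} (X : Set (ℤ → S)) (m j : (ℤ → S) → (ℤ → S) → (ℤ → S)) :
    Setoid X where
  r x y := ∀ t, IsAffine X m j t → t x.1 0 = t y.1 0
  iseqv := ⟨fun _ _ _ => rfl, fun h t ht => (h t ht).symm,
    fun h h' t ht => (h t ht).trans (h' t ht)⟩

theorem finite_affineSetoid_quotient {S : Type*} [Finite S] {X : Set (ℤ → S)}
    {m j : (ℤ → S) → (ℤ → S) → (ℤ → S)} {r : ℕ}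
    (hr : ∀ t : (ℤ → S) → (ℤ → S), IsAffine X m j t → HasRadius1 X t r) :
    Finite (Quotient (affineSetoid X m j)) := by
  refine Finite.of_injective
    (β := Set.Icc (-(r : ℤ)) r → S) (fun a k => a.out.1 k) fun a b hab => ?_
  refine Quotient.out_equiv_out.1 fun t ht => hr t ht _ a.out.2 _ b.out.2 0 fun k hk => ?_
  exact congrFun hab ⟨k, abs_le.1 (by simpa using hk)⟩

theorem algConjToCellwise_empty {S : Type*} [Finite S]
    (m j : (ℤ → S) → (ℤ → S) → (ℤ → S)) : AlgConjToCellwise ∅ m j := by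
  obtain ⟨n, ⟨e⟩⟩ := Finite.exists_equiv_fin S
  refine ⟨Fin n, inferInstance, inferInstance, ∅, ⟨by simp, by simp, fun x hx => ?_⟩, by simp,
    fun x i => e (x i), fun x i => e.symm (x i), Set.bijOn_empty _, by simp, ⟨0, ?_⟩, ⟨0, ?_⟩,
    by simp, by simp, by simp⟩
  · simpa using hx 0
  · rintro x ⟨⟩
  · rintro x ⟨⟩

theorem algConjToCellwise_of_affine_radius {S : Type*} [Finite S] {X : Set (ℤ → S)}
    {m j : (ℤ → S) → (ℤ → S) → (ℤ → S)} (hL : IsLatticeSubshift X m j) {r : ℕ}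
    (hr : ∀ t : (ℤ → S) → (ℤ → S), IsAffine X m j t → HasRadius1 X t r) :
    AlgConjToCellwise X m j := by
  classical
  rcases X.eq_empty_or_nonempty with rfl | ⟨x₀, hx₀⟩
  · exact algConjToCellwise_empty m j
  have hX := hL.subshift
  have := finite_affineSetoid_quotient hr
  -- a small model `T` of the quotient, with projection `q`
  obtain ⟨T, _, q, hq, hqR⟩ : ∃ (T : Type) (_ : Fintype T) (q : X → T), Function.Surjective q ∧
      ∀ x y, q x = q y ↔ ∀ t, IsAffine X m j t → t x.1 0 = t y.1 0 := by
    obtain ⟨n, ⟨e⟩⟩ := Finite.exists_equiv_fin (Quotient (affineSetoid X m j))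
    exact ⟨Fin n, inferInstance, fun x => e ⟦x⟧, e.surjective.comp Quotient.mk_surjective,
      fun x y => e.injective.eq_iff.trans Quotient.eq⟩
  let M : X → X → X := fun x y => ⟨m x y, hL.meet_mem _ x.2 _ y.2⟩
  let J : X → X → X := fun x y => ⟨j x y, hL.join_mem _ x.2 _ y.2⟩
  have M_comm : ∀ x y, M x y = M y x := fun x y => Subtype.ext (hL.meet_comm _ x.2 _ y.2)
  have J_comm : ∀ x y, J x y = J y x := fun x y => Subtype.ext (hL.join_comm _ x.2 _ y.2)
  have hM₁ : ∀ x x' y, q x = q x' → q (M x y) = q (M x' y) := fun x x' y h =>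
    (hqR _ _).2 fun t ht => (hqR _ _).1 h _ (ht.comp (.meet _ y.1 y.2 .id))
  have hJ₁ : ∀ x x' y, q x = q x' → q (J x y) = q (J x' y) := fun x x' y h =>
    (hqR _ _).2 fun t ht => (hqR _ _).1 h _ (ht.comp (.join _ y.1 y.2 .id))
  obtain ⟨iL, hqM, hqJ⟩ := exists_lattice_of_surjective hq M J
    (fun x x' y y' h h' => by rw [hM₁ _ _ _ h, M_comm, hM₁ _ _ _ h', M_comm])
    (fun x x' y y' h h' => by rw [hJ₁ _ _ _ h, J_comm, hJ₁ _ _ _ h', J_comm])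
    M_comm J_comm
    (fun x y z => Subtype.ext (hL.meet_assoc _ x.2 _ y.2 _ z.2))
    (fun x y z => Subtype.ext (hL.join_assoc _ x.2 _ y.2 _ z.2))
    (fun x y => Subtype.ext (hL.absorb_meet _ x.2 _ y.2))
    (fun x y => Subtype.ext (hL.absorb_join _ x.2 _ y.2))
  choose out hout using hq
  let φ : (ℤ → S) → ℤ → T := fun x i =>
    if h : shiftBy i x ∈ X then q ⟨shiftBy i x, h⟩ else q ⟨x₀, hx₀⟩
  let ψ : (ℤ → T) → ℤ → S := fun y i => (out (y i)).1 0
  have hφ : ∀ x (hx : x ∈ X) i, φ x i = q ⟨shiftBy i x, hX.shiftBy_mem hx i⟩ :=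
    fun x hx i => dif_pos _
  have hψφ : ∀ x ∈ X, ψ (φ x) = x := by
    intro x hx
    funext i
    have h := (hqR _ _).1 (hout (φ x i) |>.trans (hφ x hx i)) _ .id
    simpa [shiftBy] using h
  have hφr : HasRadius1 X φ r := by
    intro x hx y hy i hxy
    rw [hφ x hx, hφ y hy, hqR]
    refine fun t ht => hr t ht _ (hX.shiftBy_mem hx i) _ (hX.shiftBy_mem hy i) 0 fun k hk => ?_
    exact hxy _ (by simpa using hk)
  have hφs : ∀ x ∈ X, φ (shiftMap x) = shiftMap (φ x) := by
    intro x hx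
    funext i
    rw [shiftMap, hφ _ (hX.1 x hx), hφ x hx]
    simp only [shiftBy_shiftMap]
  have hφm : ∀ x ∈ X, ∀ y ∈ X, φ (m x y) = fun i => φ x i ⊓ φ y i := by
    intro x hx y hy
    funext i
    rw [hφ _ (hL.meet_mem x hx y hy), hφ x hx, hφ y hy, ← hqM]
    simp only [M, hX.shiftBy_op hL.meet_shift hx hy]
  have hφj : ∀ x ∈ X, ∀ y ∈ X, φ (j x y) = fun i => φ x i ⊔ φ y i := by
    intro x hx y hy
    funext i
    rw [hφ _ (hL.join_mem x hx y hy), hφ x hx, hφ y hy, ← hqJ]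
    simp only [J, hX.shiftBy_op hL.join_shift hx hy]
  refine ⟨T, inferInstance, iL, φ '' X, ⟨?_, ?_, ?_⟩, ?_, φ, ψ,
    ⟨Set.mapsTo_image _ _, Set.LeftInvOn.injOn hψφ, Set.surjOn_image _ _⟩, hψφ, ⟨r, hφr⟩,
    ⟨0, ?_⟩, hφs, hφm, hφj⟩
  · rintro _ ⟨x, hx, rfl⟩
    exact ⟨_, hX.1 x hx, hφs x hx⟩
  · rintro _ ⟨x, hx, rfl⟩
    obtain ⟨y, hy, rfl⟩ := hX.2.1 x hx
    exact ⟨_, ⟨y, hy, rfl⟩, (hφs y hy).symm⟩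
  · intro y hy
    have approx : ∀ n : ℕ, ∃ x ∈ X, ∀ i : ℤ, |i| ≤ (n : ℤ) → φ x i = y i ∧ x i = ψ y i := by
      intro n
      obtain ⟨_, ⟨x, hx, rfl⟩, h⟩ := hy n
      refine ⟨x, hx, fun i hi => ⟨h i hi, ?_⟩⟩
      calc x i = ψ (φ x) i := by rw [hψφ x hx]
        _ = ψ y i := by simp only [ψ, h i hi]
    have hyX : ψ y ∈ X := hX.2.2 _ fun n =>
      let ⟨x, hx, h⟩ := approx n
      ⟨x, hx, fun i hi => (h i hi).2⟩
    refine ⟨ψ y, hyX, funext fun i => ?_⟩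
    obtain ⟨x, hx, h⟩ := approx (i.natAbs + r)
    rw [← (h i (by push_cast; omega)).1]
    refine hφr _ hyX _ hx i fun k hk => (h k ?_).2.symm
    rw [abs_le] at *
    omega
  · rintro _ ⟨x, hx, rfl⟩ _ ⟨y, hy, rfl⟩
    exact ⟨⟨_, hL.meet_mem x hx y hy, hφm x hx y hy⟩, ⟨_, hL.join_mem x hx y hy, hφj x hx y hy⟩⟩
  · intro y _ z _ i h
    simp only [ψ, h i (by simp)]

/-- Theorem: a lattice subshift is algebraically conjugate to a cellwise lattice subshift
iff its affine maps have uniformly bounded radii. -/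
theorem stmt7 {S : Type*} [Fintype S]
    (X : Set (ℤ → S)) (m j : (ℤ → S) → (ℤ → S) → (ℤ → S))
    (hL : IsLatticeSubshift X m j) :
    AlgConjToCellwise X m j ↔
      ∃ r : ℕ, ∀ t : (ℤ → S) → (ℤ → S), IsAffine X m j t → HasRadius1 X t r :=
  ⟨fun h => h.exists_affine_radius hL,
    fun ⟨_, hr⟩ => algConjToCellwise_of_affine_radius hL hr⟩
end

section
/- Let S be a finite type and X ⊆ S^ℤ a nonempty subshift equipped with a Boolean algebra structure (⊓, ⊔, complement, 0, 1) such that ⊓, ⊔ and complement are block maps (continuous and shift-equivariant). Then X is algebraically conjugate to a product of a full shift and a finite shift: there exist finite Boolean algebras B and C, a finite subshift P ⊆ C^ℤ closed under the cellwise Boolean operations of C, and a bijection φ : X → B^ℤ × P that is a homeomorphism, commutes with the shift (where the shift acts as σ on each factor), and is a Boolean algebra isomorphism onto B^ℤ × P with its componentwise cellwise Boolean operations. -/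
/-- Algebraic conjugacy data of a Boolean algebraic subshift `(X, m, j, c, b0, b1)`
(meet, join, complement, bottom, top) with the product of the full shift `B^ℤ` and a
subshift `P ⊆ C^ℤ` closed under the cellwise Boolean operations of the finite Boolean
algebra `C`: `φ` is a shift-commuting bijection of `X` with `univ ×ˢ P` which is a
Boolean algebra isomorphism; both `φ` and its inverse `ψ` are block maps. -/
def BoolConjugacyData {S : Type*} (X : Set (ℤ → S))
    (m j : (ℤ → S) → (ℤ → S) → (ℤ → S)) (c : (ℤ → S) → (ℤ → S)) (b0 b1 : ℤ → S)
    {B C : Type} [BooleanAlgebra B] [BooleanAlgebra C] (P : Set (ℤ → C)) : Prop :=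
  IsSubshift P ∧ P.Finite ∧
  (∀ y ∈ P, ∀ z ∈ P, (fun i => y i ⊓ z i) ∈ P ∧ (fun i => y i ⊔ z i) ∈ P) ∧
  (∀ y ∈ P, (fun i => (y i)ᶜ) ∈ P) ∧
  ∃ (φ : (ℤ → S) → (ℤ → B) × (ℤ → C)) (ψ : (ℤ → B) × (ℤ → C) → (ℤ → S)),
    Set.BijOn φ X (Set.univ ×ˢ P) ∧
    (∀ x ∈ X, ψ (φ x) = x) ∧
    (∃ r : ℕ, HasRadius1 X (fun x => (φ x).1) r) ∧
    (∃ r : ℕ, HasRadius1 X (fun x => (φ x).2) r) ∧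
    (∃ r : ℕ, ∀ z ∈ ((Set.univ : Set (ℤ → B)) ×ˢ P), ∀ w ∈ ((Set.univ : Set (ℤ → B)) ×ˢ P), ∀ i : ℤ,
      (∀ l : ℤ, |l - i| ≤ (r : ℤ) → z.1 l = w.1 l ∧ z.2 l = w.2 l) → ψ z i = ψ w i) ∧
    (∀ x ∈ X, φ (shiftMap x) = (shiftMap (φ x).1, shiftMap (φ x).2)) ∧
    (∀ x ∈ X, ∀ y ∈ X, φ (m x y) =
      ((fun i => (φ x).1 i ⊓ (φ y).1 i), (fun i => (φ x).2 i ⊓ (φ y).2 i))) ∧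
    (∀ x ∈ X, ∀ y ∈ X, φ (j x y) =
      ((fun i => (φ x).1 i ⊔ (φ y).1 i), (fun i => (φ x).2 i ⊔ (φ y).2 i))) ∧
    (∀ x ∈ X, φ (c x) = ((fun i => ((φ x).1 i)ᶜ), (fun i => ((φ x).2 i)ᶜ))) ∧
    φ b0 = ((fun _ => ⊥), (fun _ => ⊥)) ∧ φ b1 = ((fun _ => ⊤), (fun _ => ⊤))

/-- Finitely many pairwise distinct two-valued homomorphisms can be told apart from any one
of them by a single element. -/
theorem BoundedLatticeHom.exists_eq_true_and_eq_false {Y : Type*} [BooleanAlgebra Y]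
    (g : BoundedLatticeHom Y Bool) (G : Finset (BoundedLatticeHom Y Bool)) (hg : g ∉ G) :
    ∃ e, g e = true ∧ ∀ g' ∈ G, g' e = false := by
  classical
  induction G using Finset.induction_on with
  | empty => exact ⟨⊤, by simp, by simp⟩
  | insert g₁ G _ ih =>
    obtain ⟨e, he, he'⟩ := ih fun h => hg (Finset.mem_insert_of_mem h)
    have hne : g ≠ g₁ := fun h => hg (h ▸ Finset.mem_insert_self _ _)
    obtain ⟨x, hx⟩ := DFunLike.ne_iff.mp hne
    have : ∃ d, g d = true ∧ g₁ d = false := by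
      cases h1 : g x <;> cases h2 : g₁ x
      · simp_all
      · exact ⟨xᶜ, by simp [h1], by simp [h2]⟩
      · exact ⟨x, h1, h2⟩
      · simp_all
    obtain ⟨d, hd, hd'⟩ := this
    refine ⟨e ⊓ d, by simp [he, hd], fun g' hg' => ?_⟩
    rcases Finset.mem_insert.mp hg' with rfl | hg'
    · simp [hd']
    · simp [he' g' hg']

/-- Distinct two-valued homomorphisms are independent: finitely many of them take arbitrary
prescribed values simultaneously. -/
theorem BoundedLatticeHom.exists_forall_mem_finset_eq {Y : Type*} [BooleanAlgebra Y]
    (t : BoundedLatticeHom Y Bool → Bool) (G : Finset (BoundedLatticeHom Y Bool)) :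
    ∃ x, ∀ g ∈ G, g x = t g := by
  classical
  induction G using Finset.induction_on with
  | empty => exact ⟨⊤, by simp⟩
  | insert g₁ G hg₁ ih =>
    obtain ⟨x, hx⟩ := ih
    obtain ⟨e, he, he'⟩ := g₁.exists_eq_true_and_eq_false G hg₁
    cases ht : t g₁
    · refine ⟨x ⊓ eᶜ, fun g hg => ?_⟩
      rcases Finset.mem_insert.mp hg with rfl | hg
      · simp [he, ht]
      · simp [he' g hg, hx g hg]
    · refine ⟨x ⊔ e, fun g hg => ?_⟩
      rcases Finset.mem_insert.mp hg with rfl | hg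
      · simp [he, ht]
      · simp [he' g hg, hx g hg]

/-- On a compact Boolean algebra, continuous two-valued homomorphisms take arbitrary prescribed
values simultaneously. -/
theorem BoundedLatticeHom.exists_forall_continuous_eq {Y : Type*} [BooleanAlgebra Y]
    [TopologicalSpace Y] [CompactSpace Y] (t : BoundedLatticeHom Y Bool → Bool) :
    ∃ x, ∀ g : BoundedLatticeHom Y Bool, Continuous g → g x = t g := by
  have := isCompact_univ.inter_iInter_nonempty
    (fun g : {g : BoundedLatticeHom Y Bool // Continuous g} => {x | g.1 x = t g.1})
    (fun g => isClosed_eq g.2 continuous_const) (fun G => by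
      classical
      obtain ⟨x, hx⟩ := exists_forall_mem_finset_eq t (G.image Subtype.val)
      refine ⟨x, trivial, Set.mem_iInter₂.mpr fun g hg => hx g.1 ?_⟩
      exact Finset.mem_image_of_mem _ hg)
  obtain ⟨x, -, hx⟩ := this
  exact ⟨x, fun g hg => Set.mem_iInter.mp hx ⟨g, hg⟩⟩

/-- The two-valued homomorphism whose kernel is a given prime ideal. -/
noncomputable def Order.Ideal.IsPrime.toBoolHom {Y : Type*} [BooleanAlgebra Y]
    (J : Order.Ideal Y) (hJ : J.IsPrime) : BoundedLatticeHom Y Bool := by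
  classical
  exact
  { toFun := fun x => decide (x ∉ J)
    map_sup' := fun x y => by
      by_cases hx : x ∈ J <;> by_cases hy : y ∈ J <;> simp [Order.Ideal.sup_mem_iff, hx, hy]
    map_inf' := fun x y => by
      have : x ⊓ y ∈ J ↔ x ∈ J ∨ y ∈ J :=
        ⟨hJ.mem_or_mem, fun h => h.elim (J.lower inf_le_left) (J.lower inf_le_right)⟩
      by_cases hx : x ∈ J <;> by_cases hy : y ∈ J <;> simp [this, hx, hy]
    map_top' := by simpa using hJ.toIsProper.top_notMem
    map_bot' := by simp }

theorem Order.Ideal.IsPrime.toBoolHom_eq_false {Y : Type*} [BooleanAlgebra Y]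
    {J : Order.Ideal Y} (hJ : J.IsPrime) {x : Y} : hJ.toBoolHom J x = false ↔ x ∈ J := by
  simp [Order.Ideal.IsPrime.toBoolHom]

/-- Two bi-infinite words agree on the window `[-n, n]`. -/
def AgreeOn {S : Type*} (n : ℕ) (x y : ℤ → S) : Prop :=
  ∀ l : ℤ, |l| ≤ n → x l = y l

theorem AgreeOn.mono {S : Type*} {n k : ℕ} {x y : ℤ → S} (h : AgreeOn n x y) (hk : k ≤ n) :
    AgreeOn k x y :=
  fun l hl => h l (hl.trans (by exact_mod_cast hk))

theorem AgreeOn.trans {S : Type*} {n : ℕ} {x y z : ℤ → S} (h : AgreeOn n x y)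
    (h' : AgreeOn n y z) : AgreeOn n x z :=
  fun l hl => (h l hl).trans (h' l hl)

/-- The Boolean operations of an algebra of bi-infinite words are local with radius `r`. -/
structure HasLocalOps {S Y : Type*} [BooleanAlgebra Y] (v : Y → ℤ → S) (r : ℕ) : Prop where
  inf : ∀ n x x' y y', AgreeOn (n + r) (v x) (v x') → AgreeOn (n + r) (v y) (v y') →
    AgreeOn n (v (x ⊓ y)) (v (x' ⊓ y'))
  sup : ∀ n x x' y y', AgreeOn (n + r) (v x) (v x') → AgreeOn (n + r) (v y) (v y') →
    AgreeOn n (v (x ⊔ y)) (v (x' ⊔ y'))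
  compl : ∀ n x x', AgreeOn (n + r) (v x) (v x') → AgreeOn n (v xᶜ) (v x'ᶜ)

namespace HasLocalOps

variable {S Y : Type*} [BooleanAlgebra Y] {v : Y → ℤ → S} {r : ℕ}

theorem symmDiff (H : HasLocalOps v r) {n : ℕ} {x x' y y' : Y}
    (hx : AgreeOn (n + 3 * r) (v x) (v x')) (hy : AgreeOn (n + 3 * r) (v y) (v y')) :
    AgreeOn n (v (symmDiff x y)) (v (symmDiff x' y')) := by
  simp only [symmDiff_def, sdiff_eq]
  refine H.sup _ _ _ _ _ (H.inf _ _ _ _ _ ?_ ?_) (H.inf _ _ _ _ _ ?_ ?_)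
  · exact hx.mono (by omega)
  · exact H.compl _ _ _ (hy.mono (by omega))
  · exact hy.mono (by omega)
  · exact H.compl _ _ _ (hx.mono (by omega))

/-- An open ideal contained in the set of words having the same central letter as `⊥`. -/
def centralIdeal (v : Y → ℤ → S) : Order.Ideal Y where
  carrier := {x | ∀ w, (∀ y, AgreeOn 0 (v (w ⊓ y)) (v ⊥)) →
    ∀ y, AgreeOn 0 (v ((x ⊔ w) ⊓ y)) (v ⊥)}
  lower' := by
    intro x x' hle hx w hw y
    have h := hx w hw ((x' ⊔ w) ⊓ y)
    rwa [← inf_assoc, inf_eq_right.mpr (sup_le_sup_right hle w)] at h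
  nonempty' := ⟨⊥, fun w hw y => by simpa using hw y⟩
  directed' := by
    intro x hx y hy
    refine ⟨x ⊔ y, fun w hw z => ?_, le_sup_left, le_sup_right⟩
    rw [sup_assoc]
    exact hx _ (hy w hw) z

theorem agreeOn_of_mem_centralIdeal {x : Y} (hx : x ∈ centralIdeal v) :
    AgreeOn 0 (v x) (v ⊥) := by
  have := hx ⊥ (fun y => by intro l _; simp) ⊤
  simpa using this

theorem mem_centralIdeal_of_agreeOn (H : HasLocalOps v r) {x : Y}
    (h : AgreeOn (2 * r) (v x) (v ⊥)) : x ∈ centralIdeal v := by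
  intro w hw y
  refine (H.inf 0 _ (⊥ ⊔ w) _ y (H.sup _ _ _ _ _ (h.mono (by omega)) fun _ _ => rfl)
    fun _ _ => rfl).trans ?_
  simpa using hw y

/-- Two-valued homomorphisms depending only on a fixed finite window suffice to recover the
central letter of a word, using finitely many of its translates. -/
theorem exists_window (H : HasLocalOps v r) (σ : Y ≃o Y)
    (hσ : ∀ (i : ℤ) x l, v ((σ ^ i) x) l = v x (l + i)) :
    ∃ N R : ℕ, ∀ x y, (∀ i : ℤ, |i| ≤ R → ∀ h : BoundedLatticeHom Y Bool,
      (∀ a b, AgreeOn N (v a) (v b) → h a = h b) → h ((σ ^ i) x) = h ((σ ^ i) y)) →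
      v x 0 = v y 0 := by
  refine ⟨5 * r, 3 * r, fun x y hxy => ?_⟩
  have key : ∀ i : ℤ, |i| ≤ (3 * r : ℕ) → v (_root_.symmDiff x y) i = v ⊥ i := by
    intro i hi
    have hmem : _root_.symmDiff ((σ ^ i) x) ((σ ^ i) y) ∈ centralIdeal v := by
      by_contra hn
      obtain ⟨J, hJ, hIJ, hd⟩ := DistribLattice.prime_ideal_of_disjoint_filter_ideal
        (F := Order.PFilter.principal (_root_.symmDiff ((σ ^ i) x) ((σ ^ i) y)))
        (I := centralIdeal v) (by
          rw [Set.disjoint_left]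
          intro z hz hz'
          exact hn ((centralIdeal v).lower (Order.PFilter.mem_principal.mp hz) hz'))
      have hnJ : _root_.symmDiff ((σ ^ i) x) ((σ ^ i) y) ∉ J := fun h =>
        Set.disjoint_left.mp hd (Order.PFilter.mem_principal.mpr le_rfl) h
      have hinv : ∀ a b, AgreeOn (5 * r) (v a) (v b) → hJ.toBoolHom J a = hJ.toBoolHom J b := by
        intro a b hab
        have h1 : _root_.symmDiff a b ∈ J := hIJ (H.mem_centralIdeal_of_agreeOn (by
          have := H.symmDiff (n := 2 * r) (x := a) (x' := b) (y := b) (y' := b)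
            (hab.mono (by omega)) (fun _ _ => rfl)
          simpa using this))
        have h2 := hJ.toBoolHom_eq_false.mpr h1
        rw [map_symmDiff'] at h2
        exact symmDiff_eq_bot.mp h2
      apply hnJ
      rw [← hJ.toBoolHom_eq_false, map_symmDiff', hxy i hi _ hinv]
      exact symmDiff_self _
    have h0 := agreeOn_of_mem_centralIdeal hmem 0 (by simp)
    rw [← map_symmDiff (σ ^ i), hσ] at h0
    have hb : v ((σ ^ i) ⊥) 0 = v ⊥ (0 + i) := hσ i ⊥ 0
    rw [map_bot] at hb
    simpa [hb] using h0
  have := H.symmDiff (n := 0) (x := y) (x' := y) (y := _root_.symmDiff x y) (y' := ⊥)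
    (fun _ _ => rfl) (fun l hl => key l (by simpa using hl)) 0 (by simp)
  rwa [symmDiff_comm x y, symmDiff_symmDiff_cancel_left, symmDiff_bot] at this

/-- There are only finitely many two-valued homomorphisms depending on a given finite window. -/
theorem finite_boolHoms [Finite S] (v : Y → ℤ → S) (N : ℕ) :
    Finite {h : BoundedLatticeHom Y Bool // ∀ a b, AgreeOn N (v a) (v b) → h a = h b} := by
  let res : Y → (Set.Icc (-(N : ℤ)) N → S) := fun x l => v x l
  have hres : ∀ x y, res x = res y → AgreeOn N (v x) (v y) := fun x y h l hl =>
    congrFun h ⟨l, abs_le.mp hl⟩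
  refine Finite.of_injective
    (fun h => res '' {x | h.1 x = true}) (fun h h' heq => Subtype.ext (DFunLike.ext _ _ ?_))
  have aux : ∀ g g' : {h : BoundedLatticeHom Y Bool // ∀ a b, AgreeOn N (v a) (v b) → h a = h b},
      res '' {x | g.1 x = true} = res '' {x | g'.1 x = true} → ∀ x, g.1 x = true →
        g'.1 x = true := by
    intro g g' hgg x hx
    obtain ⟨y, hy, hyx⟩ := hgg ▸ Set.mem_image_of_mem res hx
    rw [← g'.2 y x (hres y x hyx)]
    exact hy
  intro x
  rw [Bool.eq_iff_iff]
  exact ⟨aux h h' heq x, aux h' h heq.symm x⟩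

end HasLocalOps

/-- The composition of a two-valued homomorphism with a power of an automorphism. -/
noncomputable def BoundedLatticeHom.compZPow {Y : Type*} [BooleanAlgebra Y] (σ : Y ≃o Y)
    (h : BoundedLatticeHom Y Bool) (i : ℤ) : BoundedLatticeHom Y Bool :=
  h.comp ((σ ^ i : Y ≃o Y) : BoundedLatticeHom Y Y)

@[simp]
theorem BoundedLatticeHom.compZPow_apply {Y : Type*} [BooleanAlgebra Y] (σ : Y ≃o Y)
    (h : BoundedLatticeHom Y Bool) (i : ℤ) (x : Y) : h.compZPow σ i x = h ((σ ^ i) x) :=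
  rfl

theorem OrderIso.zpow_add_apply {Y : Type*} [LE Y] (σ : Y ≃o Y) (i j : ℤ) (x : Y) :
    (σ ^ (i + j)) x = (σ ^ i) ((σ ^ j) x) := by
  rw [zpow_add]; rfl

/-- A compact Boolean algebra of words with local operations has coordinates given by two finite
families of homomorphisms: one whose translates are free, and one consisting of homomorphisms
which are periodic under the automorphism. -/
theorem HasLocalOps.exists_coordinates {S Y : Type*} [Finite S] [BooleanAlgebra Y]
    [TopologicalSpace Y] [CompactSpace Y] {v : Y → ℤ → S} {r : ℕ} (H : HasLocalOps v r)
    (σ : Y ≃o Y) (hσ : ∀ (i : ℤ) x l, v ((σ ^ i) x) l = v x (l + i))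
    (hcont : ∀ (N : ℕ) (h : BoundedLatticeHom Y Bool),
      (∀ a b, AgreeOn N (v a) (v b) → h a = h b) → Continuous h) :
    ∃ (K L : Type) (_ : Finite K) (_ : Finite L) (f : K → BoundedLatticeHom Y Bool)
      (g : L → BoundedLatticeHom Y Bool) (N R : ℕ),
      (∀ k a b, AgreeOn N (v a) (v b) → f k a = f k b) ∧
      (∀ k a b, AgreeOn N (v a) (v b) → g k a = g k b) ∧
      (∀ k, ∃ n : ℤ, 0 < n ∧ ∀ x, g k ((σ ^ n) x) = g k x) ∧
      (∀ (z : ℤ → K → Bool) (x₀ : Y), ∃ x, (∀ i k, f k ((σ ^ i) x) = z i k) ∧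
        ∀ (i : ℤ) k, g k ((σ ^ i) x) = g k ((σ ^ i) x₀)) ∧
      ∀ x y, (∀ i : ℤ, |i| ≤ R → (∀ k, f k ((σ ^ i) x) = f k ((σ ^ i) y)) ∧
        ∀ k, g k ((σ ^ i) x) = g k ((σ ^ i) y)) → v x 0 = v y 0 := by
  classical
  obtain ⟨N, R, hNR⟩ := H.exists_window σ hσ
  have := HasLocalOps.finite_boolHoms v N
  obtain ⟨n, ⟨e⟩⟩ := Finite.exists_equiv_fin
    {h : BoundedLatticeHom Y Bool // ∀ a b, AgreeOn N (v a) (v b) → h a = h b}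
  let q : Fin n → BoundedLatticeHom Y Bool := fun a => (e.symm a).1
  have hq : ∀ k a b, AgreeOn N (v a) (v b) → q k a = q k b := fun k => (e.symm k).2
  have hqs : ∀ h : BoundedLatticeHom Y Bool, (∀ a b, AgreeOn N (v a) (v b) → h a = h b) →
      ∃ k, q k = h := fun h hh => ⟨e ⟨h, hh⟩, by simp [q]⟩
  have hqc : ∀ k i, Continuous ((q k).compZPow σ i) := by
    intro k i
    refine hcont (N + i.natAbs) _ fun a b hab => ?_
    simp only [BoundedLatticeHom.compZPow_apply]
    refine hq k _ _ fun l hl => ?_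
    rw [hσ, hσ]
    apply hab
    rw [abs_le] at *
    omega
  let s : Setoid (Fin n) :=
    { r := fun a b => ∃ i : ℤ, ∀ x, q a x = q b ((σ ^ i) x)
      iseqv :=
        { refl := fun a => ⟨0, by simp⟩
          symm := by
            rintro a b ⟨i, hi⟩
            refine ⟨-i, fun x => ?_⟩
            rw [hi, ← OrderIso.zpow_add_apply]
            simp
          trans := by
            rintro a b d ⟨i, hi⟩ ⟨j, hj⟩
            refine ⟨j + i, fun x => ?_⟩
            rw [hi, hj, OrderIso.zpow_add_apply] } }
  let Per : Fin n → Prop := fun a => ∃ i : ℤ, 0 < i ∧ ∀ x, q a ((σ ^ i) x) = q a x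
  have hPer : ∀ a b, s a b → Per b → Per a := by
    rintro a b ⟨i, hi⟩ ⟨p, hp, hb⟩
    refine ⟨p, hp, fun x => ?_⟩
    rw [hi, hi, ← OrderIso.zpow_add_apply, add_comm, OrderIso.zpow_add_apply, hb]
  let rep : Fin n → Fin n := fun a => (Quotient.mk s a).out
  have hrep : ∀ a, s a (rep a) := fun a => s.symm (Quotient.mk_out a)
  have hrep' : ∀ a b, s a b → rep a = rep b := fun a b hab =>
    congrArg Quotient.out (Quotient.sound hab)
  have hinj : ∀ a b, rep a = a → rep b = b → ¬ Per a → ∀ i j : ℤ,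
      (q a).compZPow σ i = (q b).compZPow σ j → a = b ∧ i = j := by
    intro a b ha hb hp i j hij
    have hij' : ∀ x, q a ((σ ^ i) x) = q b ((σ ^ j) x) := fun x => DFunLike.congr_fun hij x
    have hab : a = b := by
      rw [← ha, ← hb]
      refine hrep' a b ⟨j - i, fun x => ?_⟩
      have := hij' ((σ ^ (-i)) x)
      rw [← OrderIso.zpow_add_apply, ← OrderIso.zpow_add_apply] at this
      simpa [sub_eq_add_neg] using this
    subst hab
    refine ⟨rfl, ?_⟩
    rcases lt_trichotomy i j with h | h | h
    · refine (hp ⟨j - i, by omega, fun x => ?_⟩).elim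
      have := hij' ((σ ^ (-i)) x)
      rw [← OrderIso.zpow_add_apply, ← OrderIso.zpow_add_apply] at this
      simpa [sub_eq_add_neg] using this.symm
    · exact h
    · refine (hp ⟨i - j, by omega, fun x => ?_⟩).elim
      have := hij' ((σ ^ (-j)) x)
      rw [← OrderIso.zpow_add_apply, ← OrderIso.zpow_add_apply] at this
      simpa [sub_eq_add_neg] using this
  choose d hd using hrep
  refine ⟨{a // rep a = a ∧ ¬ Per a}, {a // Per a}, inferInstance, inferInstance,
    fun a => q a, fun a => q a, N, R + Finset.univ.sup fun a => (d a).natAbs,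
    fun k => hq k, fun k => hq k, fun k => k.2, ?_, ?_⟩
  · intro z x₀
    let t : BoundedLatticeHom Y Bool → Bool := fun g =>
      if h : ∃ p : {a // rep a = a ∧ ¬ Per a} × ℤ, g = (q p.1).compZPow σ p.2 then
        z h.choose.2 h.choose.1 else g x₀
    obtain ⟨x, hx⟩ := BoundedLatticeHom.exists_forall_continuous_eq t
    refine ⟨x, fun i k => ?_, fun i k => ?_⟩
    · have h : ∃ p : {a // rep a = a ∧ ¬ Per a} × ℤ,
          (q k).compZPow σ i = (q p.1).compZPow σ p.2 := ⟨(k, i), rfl⟩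
      have h1 := hinj k h.choose.1 k.2.1 h.choose.1.2.1 k.2.2 _ _ h.choose_spec
      have h2 : k = h.choose.1 := Subtype.ext h1.1
      have h3 := hx _ (hqc k i)
      simp only [t, dif_pos h] at h3
      rw [← h1.2, ← h2] at h3
      exact h3
    · have h : ¬ ∃ p : {a // rep a = a ∧ ¬ Per a} × ℤ,
          (q k).compZPow σ i = (q p.1).compZPow σ p.2 := by
        rintro ⟨p, hp⟩
        refine p.1.2.2 (hPer _ k ⟨i - p.2, fun x => ?_⟩ k.2)
        have := DFunLike.congr_fun hp ((σ ^ (-p.2)) x)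
        simp only [BoundedLatticeHom.compZPow_apply, ← OrderIso.zpow_add_apply] at this
        simpa [sub_eq_add_neg] using this.symm
      have h3 := hx _ (hqc k i)
      simp only [t, dif_neg h] at h3
      exact h3
  · intro x y hxy
    refine hNR x y fun i hi h hh => ?_
    obtain ⟨a, rfl⟩ := hqs h hh
    by_cases ha : Per a
    · exact (hxy i (hi.trans (by push_cast; omega))).2 ⟨a, ha⟩
    · have h1 : rep (rep a) = rep a := (hrep' _ _ ⟨d a, hd a⟩).symm
      have h2 : ¬ Per (rep a) := fun h => ha (hPer _ _ ⟨d a, hd a⟩ h)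
      have hle : (d a).natAbs ≤ Finset.univ.sup fun a => (d a).natAbs :=
        Finset.le_sup (f := fun a => (d a).natAbs) (Finset.mem_univ a)
      rw [hd a ((σ ^ i) x), hd a ((σ ^ i) y), ← OrderIso.zpow_add_apply, ← OrderIso.zpow_add_apply]
      refine (hxy (d a + i) ?_).1 ⟨rep a, h1, h2⟩
      rw [abs_le] at *
      push_cast
      omega

/-- A shift-invariant finite set of words is a subshift. -/
theorem IsSubshift.of_finite {α : Type*} {P : Set (ℤ → α)} (hP : P.Finite)
    (h : ∀ x ∈ P, shiftMap x ∈ P) (h' : ∀ x ∈ P, ∃ y ∈ P, shiftMap y = x) : IsSubshift P := by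
  refine ⟨h, h', fun x hx => ?_⟩
  choose y hyP hy using hx
  have := hP.to_subtype
  obtain ⟨p, hp⟩ := Finite.exists_infinite_fiber fun n => (⟨y n, hyP n⟩ : P)
  have hx : x = p := by
    funext i
    obtain ⟨n, hn, hin⟩ := (Set.infinite_coe_iff.mp hp).exists_gt i.natAbs
    rw [← hy n i (by rw [Int.abs_eq_natAbs]; omega), ← show y n = p from congrArg Subtype.val hn]
  exact hx ▸ p.2

/-- The Boolean algebra structure on a set of words given by operations satisfying the
Boolean algebra axioms on it. -/
abbrev BooleanAlgebra.ofOpsOn {α : Type*} (X : Set α) (m j : α → α → α) (c : α → α) (b0 b1 : α)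
    (hb0 : b0 ∈ X) (hb1 : b1 ∈ X)
    (hm_mem : ∀ x ∈ X, ∀ y ∈ X, m x y ∈ X)
    (hj_mem : ∀ x ∈ X, ∀ y ∈ X, j x y ∈ X)
    (hc_mem : ∀ x ∈ X, c x ∈ X)
    (hm_comm : ∀ x ∈ X, ∀ y ∈ X, m x y = m y x)
    (hj_comm : ∀ x ∈ X, ∀ y ∈ X, j x y = j y x)
    (hm_assoc : ∀ x ∈ X, ∀ y ∈ X, ∀ z ∈ X, m (m x y) z = m x (m y z))
    (hj_assoc : ∀ x ∈ X, ∀ y ∈ X, ∀ z ∈ X, j (j x y) z = j x (j y z))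
    (habsorb_m : ∀ x ∈ X, ∀ y ∈ X, m x (j x y) = x)
    (habsorb_j : ∀ x ∈ X, ∀ y ∈ X, j x (m x y) = x)
    (hdistrib : ∀ x ∈ X, ∀ y ∈ X, ∀ z ∈ X, m x (j y z) = j (m x y) (m x z))
    (hbot : ∀ x ∈ X, m x b0 = b0) (htop : ∀ x ∈ X, j x b1 = b1)
    (hcompl_m : ∀ x ∈ X, m x (c x) = b0) (hcompl_j : ∀ x ∈ X, j x (c x) = b1) :
    BooleanAlgebra X :=
  letI : Max X := ⟨fun x y => ⟨j x y, hj_mem x x.2 y y.2⟩⟩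
  letI : Min X := ⟨fun x y => ⟨m x y, hm_mem x x.2 y y.2⟩⟩
  letI : Lattice X := Lattice.mk'
    (fun x y => Subtype.ext (hj_comm x x.2 y y.2))
    (fun x y z => Subtype.ext (hj_assoc x x.2 y y.2 z z.2))
    (fun x y => Subtype.ext (hm_comm x x.2 y y.2))
    (fun x y z => Subtype.ext (hm_assoc x x.2 y y.2 z z.2))
    (fun x y => Subtype.ext (habsorb_j x x.2 y y.2))
    (fun x y => Subtype.ext (habsorb_m x x.2 y y.2))
  letI : DistribLattice X := DistribLattice.ofInfSupLe
    (fun x y z => le_of_eq (Subtype.ext (hdistrib x x.2 y y.2 z z.2)))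
  { (inferInstance : DistribLattice X) with
    compl := fun x => ⟨c x, hc_mem x x.2⟩
    top := ⟨b1, hb1⟩
    bot := ⟨b0, hb0⟩
    le_top := fun x => sup_eq_right.mp (Subtype.ext (htop x x.2))
    bot_le := fun x => inf_eq_right.mp (Subtype.ext (hbot x x.2))
    inf_compl_le_bot := fun x => le_of_eq (Subtype.ext (hcompl_m x x.2))
    top_le_sup_compl := fun x => le_of_eq (Subtype.ext (hcompl_j x x.2).symm) }

theorem isOpen_setOf_agreeOn {S : Type*} [TopologicalSpace S] [DiscreteTopology S] (n : ℕ)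
    (x : ℤ → S) : IsOpen {y | AgreeOn n y x} := by
  have : {y | AgreeOn n y x} = (Set.Icc (-(n : ℤ)) n).pi fun i => {x i} := by
    ext y
    simp [AgreeOn, Set.mem_pi, abs_le]
  rw [this]
  exact isOpen_set_pi (Set.finite_Icc _ _) fun i _ => isOpen_discrete _

/-- Theorem: every Boolean algebraic subshift is algebraically conjugate to the product
of a full shift and a finite shift (over finite Boolean algebras, with cellwise
operations). -/
theorem stmt12 {S : Type*} [Fintype S]
    (X : Set (ℤ → S)) (hX : IsSubshift X) (hne : X.Nonempty)
    (m j : (ℤ → S) → (ℤ → S) → (ℤ → S)) (c : (ℤ → S) → (ℤ → S)) (b0 b1 : ℤ → S)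
    (hb0 : b0 ∈ X) (hb1 : b1 ∈ X)
    (hm_mem : ∀ x ∈ X, ∀ y ∈ X, m x y ∈ X)
    (hj_mem : ∀ x ∈ X, ∀ y ∈ X, j x y ∈ X)
    (hc_mem : ∀ x ∈ X, c x ∈ X)
    (hm_comm : ∀ x ∈ X, ∀ y ∈ X, m x y = m y x)
    (hj_comm : ∀ x ∈ X, ∀ y ∈ X, j x y = j y x)
    (hm_assoc : ∀ x ∈ X, ∀ y ∈ X, ∀ z ∈ X, m (m x y) z = m x (m y z))
    (hj_assoc : ∀ x ∈ X, ∀ y ∈ X, ∀ z ∈ X, j (j x y) z = j x (j y z))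
    (habsorb_m : ∀ x ∈ X, ∀ y ∈ X, m x (j x y) = x)
    (habsorb_j : ∀ x ∈ X, ∀ y ∈ X, j x (m x y) = x)
    (hdistrib : ∀ x ∈ X, ∀ y ∈ X, ∀ z ∈ X, m x (j y z) = j (m x y) (m x z))
    (hbot : ∀ x ∈ X, m x b0 = b0) (htop : ∀ x ∈ X, j x b1 = b1)
    (hcompl_m : ∀ x ∈ X, m x (c x) = b0) (hcompl_j : ∀ x ∈ X, j x (c x) = b1)
    (hm_rad : ∃ r : ℕ, HasRadius2 X X m r)
    (hj_rad : ∃ r : ℕ, HasRadius2 X X j r)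
    (hc_rad : ∃ r : ℕ, HasRadius1 X c r)
    (hm_shift : ∀ x ∈ X, ∀ y ∈ X, shiftMap (m x y) = m (shiftMap x) (shiftMap y))
    (hj_shift : ∀ x ∈ X, ∀ y ∈ X, shiftMap (j x y) = j (shiftMap x) (shiftMap y))
    (hc_shift : ∀ x ∈ X, shiftMap (c x) = c (shiftMap x)) :
    ∃ (B C : Type) (_ : Fintype B) (_ : Fintype C)
      (iB : BooleanAlgebra B) (iC : BooleanAlgebra C) (P : Set (ℤ → C)),
      @BoolConjugacyData S X m j c b0 b1 B C iB iC P := by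
  classical
  obtain ⟨rm, hrm⟩ := hm_rad
  obtain ⟨rj, hrj⟩ := hj_rad
  obtain ⟨rc, hrc⟩ := hc_rad
  let iY : BooleanAlgebra X := BooleanAlgebra.ofOpsOn X m j c b0 b1 hb0 hb1 hm_mem hj_mem hc_mem
    hm_comm hj_comm hm_assoc hj_assoc habsorb_m habsorb_j hdistrib hbot htop hcompl_m hcompl_j
  let v : X → ℤ → S := Subtype.val
  have H : HasLocalOps v (rm + rj + rc) := by
    refine ⟨fun n x x' y y' hx hy l hl => ?_, fun n x x' y y' hx hy l hl => ?_,
      fun n x x' hx l hl => ?_⟩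
    · refine hrm x x.2 x' x'.2 y y.2 y' y'.2 l fun k hk => ?_
      have : |k| ≤ ((n + (rm + rj + rc) : ℕ) : ℤ) := by
        rw [abs_le] at *; push_cast; omega
      exact ⟨hx k this, hy k this⟩
    · refine hrj x x.2 x' x'.2 y y.2 y' y'.2 l fun k hk => ?_
      have : |k| ≤ ((n + (rm + rj + rc) : ℕ) : ℤ) := by
        rw [abs_le] at *; push_cast; omega
      exact ⟨hx k this, hy k this⟩
    · refine hrc x x.2 x' x'.2 l fun k hk => hx k ?_
      rw [abs_le] at *; push_cast; omega
  obtain ⟨hXs, hXs', hXc⟩ := hX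
  have hinj : Function.Injective (fun x : X => (⟨shiftMap x, hXs x x.2⟩ : X)) := by
    intro x y hxy
    refine Subtype.ext (funext fun i => ?_)
    have := congrFun (congrArg Subtype.val hxy) (i - 1)
    simpa [shiftMap] using this
  have hsurj : Function.Surjective (fun x : X => (⟨shiftMap x, hXs x x.2⟩ : X)) := fun x => by
    obtain ⟨y, hy, hyx⟩ := hXs' x x.2
    exact ⟨⟨y, hy⟩, Subtype.ext hyx⟩
  let σ : X ≃o X :=
    { Equiv.ofBijective _ ⟨hinj, hsurj⟩ with
      map_rel_iff' := by
        intro x y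
        rw [← inf_eq_left, ← inf_eq_left (a := x), ← hinj.eq_iff (a := x ⊓ y)]
        refine Eq.congr (Subtype.ext ?_) rfl
        exact (hm_shift x x.2 y y.2).symm }
  have hσ1 : ∀ x : X, (σ x : ℤ → S) = shiftMap x := fun x => rfl
  have hσ : ∀ (i : ℤ) x l, v ((σ ^ i) x) l = v x (l + i) := by
    intro i
    induction i using Int.induction_on with
    | zero => intro x l; simp
    | succ n ih =>
      intro x l
      rw [OrderIso.zpow_add_apply, ih, zpow_one]
      change shiftMap x.1 _ = _
      simp [shiftMap, v, add_assoc]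
    | pred n ih =>
      intro x l
      have h : shiftMap ((σ ^ (-1 : ℤ)) x).1 = x.1 := by
        rw [← hσ1, zpow_neg_one]
        exact congrArg Subtype.val (σ.apply_symm_apply x)
      rw [sub_eq_add_neg, OrderIso.zpow_add_apply, ih]
      have h' := congrFun h (l - n - 1)
      simp only [shiftMap, sub_add_cancel] at h'
      rw [show l + (-(n : ℤ) + -1) = l - n - 1 by ring, ← sub_eq_add_neg]
      exact h'
  let : TopologicalSpace S := ⊥
  have : DiscreteTopology S := ⟨rfl⟩
  have hclosed : IsClosed X := by
    refine isClosed_of_closure_subset fun x hx => hXc x fun n => ?_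
    obtain ⟨y, hy, hyX⟩ := mem_closure_iff.mp hx _ (isOpen_setOf_agreeOn n x) fun _ _ => rfl
    exact ⟨y, hyX, hy⟩
  have : CompactSpace X := isCompact_iff_compactSpace.mp hclosed.isCompact
  have hcont : ∀ (N : ℕ) (h : BoundedLatticeHom X Bool),
      (∀ a b, AgreeOn N (v a) (v b) → h a = h b) → Continuous h := by
    intro N h hh
    refine ((IsLocallyConstant.iff_exists_open _).mpr fun x => ?_).continuous
    exact ⟨_, (isOpen_setOf_agreeOn N (v x)).preimage continuous_subtype_val, fun _ _ => rfl,
      fun y hy => hh y x hy⟩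
  obtain ⟨K, L, _, _, f, g, N, R, hf, hg, hper, hfree, hwin⟩ :=
    H.exists_coordinates σ hσ hcont
  let Φ : X → (ℤ → K → Bool) × (ℤ → L → Bool) := fun x =>
    (fun i k => f k ((σ ^ i) x), fun i k => g k ((σ ^ i) x))
  have hΦwin : ∀ x y i, (∀ l : ℤ, |l - i| ≤ R → (Φ x).1 l = (Φ y).1 l ∧ (Φ x).2 l = (Φ y).2 l) →
      v x i = v y i := by
    intro x y i hxy
    have := hwin ((σ ^ i) x) ((σ ^ i) y) fun l hl => by
      have h := hxy (l + i) (by simpa using hl)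
      simp only [← OrderIso.zpow_add_apply]
      exact ⟨congrFun h.1, congrFun h.2⟩
    simpa [hσ] using this
  have hΦinj : Function.Injective Φ := fun x y hxy =>
    Subtype.ext (funext fun i => hΦwin x y i fun l _ => by simp [hxy])
  have hΦshift : ∀ x : X, Φ (σ x) = (shiftMap (Φ x).1, shiftMap (Φ x).2) := fun x => by
    have h : ∀ i : ℤ, (σ ^ i) (σ x) = (σ ^ (i + 1)) x := fun i => by
      rw [OrderIso.zpow_add_apply, zpow_one]
    exact Prod.ext (funext fun i => funext fun k => congrArg (f k) (h i))
      (funext fun i => funext fun k => congrArg (g k) (h i))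
  have hΦinf : ∀ x y : X, Φ (x ⊓ y) = Φ x ⊓ Φ y := fun x y => by
    ext <;> simp [Φ]
  have hΦsup : ∀ x y : X, Φ (x ⊔ y) = Φ x ⊔ Φ y := fun x y => by
    ext <;> simp [Φ]
  have hΦcompl : ∀ x : X, Φ xᶜ = (Φ x)ᶜ := fun x => by
    ext <;> simp [Φ]
  have hΦbot : Φ ⊥ = ⊥ := by
    ext <;> simp [Φ]
  have hΦtop : Φ ⊤ = ⊤ := by
    ext <;> simp [Φ]
  have hlocal : ∀ h : BoundedLatticeHom X Bool, (∀ a b, AgreeOn N (v a) (v b) → h a = h b) →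
      ∀ (x y : X) (i : ℤ), (∀ l : ℤ, |l - i| ≤ N → v x l = v y l) →
        h ((σ ^ i) x) = h ((σ ^ i) y) := by
    intro h hh x y i hxy
    refine hh _ _ fun l hl => ?_
    rw [hσ, hσ]
    exact hxy _ (by simpa using hl)
  let P : Set (ℤ → L → Bool) := Set.range fun x => (Φ x).2
  have hPfin : P.Finite := by
    choose p hp hgp using hper
    have hmod : ∀ y ∈ P, ∀ i k, y i k = y (i % p k) k := by
      rintro _ ⟨x, rfl⟩ i k
      have hz : ∀ (q : ℕ) x, g k ((σ ^ (p k * q)) x) = g k x := by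
        intro q
        induction q with
        | zero => simp
        | succ q ih =>
          intro x
          rw [Nat.cast_succ, mul_add, mul_one, OrderIso.zpow_add_apply, ih, hgp]
      have hz' : ∀ (q : ℤ) x, g k ((σ ^ (p k * q)) x) = g k x := by
        intro q x
        obtain ⟨q, rfl | rfl⟩ := q.eq_nat_or_neg
        · exact hz q x
        · rw [← hz q, ← OrderIso.zpow_add_apply]
          simp
      simp only [Φ]
      conv_lhs => rw [← Int.mul_ediv_add_emod i (p k), OrderIso.zpow_add_apply, hz']
    have : Finite P := by
      refine Finite.of_injective
        (fun (y : P) (k : L) (i : Set.Ico 0 (p k)) => y.1 i k) fun y y' hyy => ?_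
      refine Subtype.ext (funext fun i => funext fun k => ?_)
      rw [hmod y y.2, hmod y' y'.2]
      exact congrFun (congrFun hyy k)
        ⟨i % p k, Int.emod_nonneg _ (hp k).ne', Int.emod_lt_of_pos _ (hp k)⟩
    exact Set.toFinite P
  have hPsub : IsSubshift P := by
    refine IsSubshift.of_finite hPfin ?_ ?_
    · rintro _ ⟨x, rfl⟩
      exact ⟨σ x, by simp [hΦshift]⟩
    · rintro _ ⟨x, rfl⟩
      refine ⟨_, ⟨σ.symm x, rfl⟩, ?_⟩
      have := hΦshift (σ.symm x)
      rw [σ.apply_symm_apply] at this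
      simp [this]
  let φ : (ℤ → S) → (ℤ → K → Bool) × (ℤ → L → Bool) := fun w =>
    if h : w ∈ X then Φ ⟨w, h⟩ else ⊥
  have hφ : ∀ x : X, φ x = Φ x := fun x => dif_pos x.2
  have hbij : Set.BijOn φ X (Set.univ ×ˢ P) := by
    refine ⟨fun x hx => ⟨trivial, ⟨x, hx⟩, ?_⟩, fun x hx y hy hxy => ?_, ?_⟩
    · rw [hφ ⟨x, hx⟩]
    · rw [hφ ⟨x, hx⟩, hφ ⟨y, hy⟩] at hxy
      exact congrArg Subtype.val (hΦinj hxy)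
    · rintro ⟨z, _⟩ ⟨-, x₀, rfl⟩
      obtain ⟨x, hx, hx'⟩ := hfree z x₀
      refine ⟨x, x.2, ?_⟩
      rw [hφ]
      exact Prod.ext (funext fun i => funext fun k => hx i k)
        (funext fun i => funext fun k => hx' i k)
  have : Nonempty (ℤ → S) := ⟨b0⟩
  have hψ : ∀ x ∈ X, Function.invFunOn φ X (φ x) = x := hbij.injOn.leftInvOn_invFunOn
  refine ⟨K → Bool, L → Bool, Fintype.ofFinite _, Fintype.ofFinite _, inferInstance,
    inferInstance, P, hPsub, hPfin, ?_, ?_, φ, Function.invFunOn φ X, hbij, hψ, ⟨N, ?_⟩, ⟨N, ?_⟩,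
    ⟨R, ?_⟩, fun x hx => ?_, fun x hx y hy => ?_, fun x hx y hy => ?_, fun x hx => ?_, ?_, ?_⟩
  · rintro _ ⟨x, rfl⟩ _ ⟨y, rfl⟩
    exact ⟨⟨x ⊓ y, congrArg Prod.snd (hΦinf x y)⟩, ⟨x ⊔ y, congrArg Prod.snd (hΦsup x y)⟩⟩
  · rintro _ ⟨x, rfl⟩
    exact ⟨xᶜ, congrArg Prod.snd (hΦcompl x)⟩
  · intro x hx y hy i hxy
    simp only [hφ ⟨x, hx⟩, hφ ⟨y, hy⟩]
    exact funext fun k => hlocal (f k) (hf k) _ _ i hxy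
  · intro x hx y hy i hxy
    simp only [hφ ⟨x, hx⟩, hφ ⟨y, hy⟩]
    exact funext fun k => hlocal (g k) (hg k) _ _ i hxy
  · intro z hz w hw i hzw
    obtain ⟨x, hx, rfl⟩ := hbij.surjOn hz
    obtain ⟨y, hy, rfl⟩ := hbij.surjOn hw
    rw [hψ x hx, hψ y hy]
    rw [hφ ⟨x, hx⟩, hφ ⟨y, hy⟩] at hzw
    exact hΦwin ⟨x, hx⟩ ⟨y, hy⟩ i hzw
  · rw [hφ ⟨x, hx⟩, ← hΦshift]
    exact hφ (σ ⟨x, hx⟩)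
  · rw [hφ ⟨x, hx⟩, hφ ⟨y, hy⟩]
    exact (hφ (⟨x, hx⟩ ⊓ ⟨y, hy⟩)).trans (hΦinf _ _)
  · rw [hφ ⟨x, hx⟩, hφ ⟨y, hy⟩]
    exact (hφ (⟨x, hx⟩ ⊔ ⟨y, hy⟩)).trans (hΦsup _ _)
  · rw [hφ ⟨x, hx⟩]
    exact (hφ (⟨x, hx⟩ᶜ)).trans (hΦcompl _)
  · exact (hφ ⊥).trans hΦbot
  · exact (hφ ⊤).trans hΦtop
end

section
/- Let L be a distributive lattice with a top and a bottom element. Then every affine map of L is equal, as a function L → L, to x ↦ (x ⊓ a) ⊔ b for some a, b ∈ L. (In particular, every bounded distributive lattice is 2-shallow.) -/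
/-- The affine maps of a lattice `L`: the smallest set of functions `L → L` containing
the identity and all constants, closed under meeting and joining with constants. -/
inductive IsAffineMap {L : Type*} [Lattice L] : (L → L) → Prop
  | id : IsAffineMap (fun x => x)
  | const (c : L) : IsAffineMap (fun _ => c)
  | meet (t : L → L) (c : L) (ht : IsAffineMap t) : IsAffineMap (fun x => t x ⊓ c)
  | join (t : L → L) (c : L) (ht : IsAffineMap t) : IsAffineMap (fun x => t x ⊔ c)

/-- In a bounded distributive lattice, every affine map is of the form
`x ↦ (x ⊓ a) ⊔ b`; in particular bounded distributive lattices are 2-shallow. -/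
theorem stmt13 {L : Type*} [DistribLattice L] [BoundedOrder L]
    (t : L → L) (ht : IsAffineMap t) :
    ∃ a b : L, ∀ x : L, t x = (x ⊓ a) ⊔ b := by
  induction ht with
  | id => exact ⟨⊤, ⊥, fun x => by simp⟩
  | const c => exact ⟨⊥, c, fun x => by simp⟩
  | meet t c _ ih =>
    obtain ⟨a, b, h⟩ := ih
    exact ⟨a ⊓ c, b ⊓ c, fun x => by simp only [h, inf_sup_right, inf_assoc]⟩
  | join t c _ ih =>
    obtain ⟨a, b, h⟩ := ih
    exact ⟨a, b ⊔ c, fun x => by simp only [h, sup_assoc]⟩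
end

section
/- Let G be a group. Then every affine map of G is equal, as a function G → G, to a constant function, or to x ↦ a·x·b for some a, b ∈ G, or to x ↦ a·x⁻¹·b for some a, b ∈ G. (In particular, groups are 3-shallow.) -/
/-- The affine maps of a group `G`: the smallest set of functions `G → G` containing
the identity and all constants, closed under multiplication by a constant on either
side and under inversion. -/
inductive IsGroupAffineMap {G : Type*} [Group G] : (G → G) → Prop
  | id : IsGroupAffineMap (fun x => x)
  | const (c : G) : IsGroupAffineMap (fun _ => c)
  | mulRight (t : G → G) (c : G) (ht : IsGroupAffineMap t) :
      IsGroupAffineMap (fun x => t x * c)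
  | mulLeft (t : G → G) (c : G) (ht : IsGroupAffineMap t) :
      IsGroupAffineMap (fun x => c * t x)
  | inv (t : G → G) (ht : IsGroupAffineMap t) : IsGroupAffineMap (fun x => (t x)⁻¹)

/-- In a group, every affine map is constant, of the form `x ↦ a·x·b`, or of the form
`x ↦ a·x⁻¹·b`; in particular groups are 3-shallow. -/
theorem stmt14 {G : Type*} [Group G] (t : G → G) (ht : IsGroupAffineMap t) :
    (∃ c : G, ∀ x : G, t x = c) ∨
    (∃ a b : G, ∀ x : G, t x = a * x * b) ∨
    (∃ a b : G, ∀ x : G, t x = a * x⁻¹ * b) := by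
  induction ht with
  | id => exact Or.inr (Or.inl ⟨1, 1, fun x => by simp⟩)
  | const c => exact Or.inl ⟨c, fun _ => rfl⟩
  | mulRight t c _ ih =>
    rcases ih with ⟨d, h⟩ | ⟨a, b, h⟩ | ⟨a, b, h⟩
    · exact Or.inl ⟨d * c, fun x => by simp only [h]⟩
    · exact Or.inr (Or.inl ⟨a, b * c, fun x => by simp only [h, mul_assoc]⟩)
    · exact Or.inr (Or.inr ⟨a, b * c, fun x => by simp only [h, mul_assoc]⟩)
  | mulLeft t c _ ih =>
    rcases ih with ⟨d, h⟩ | ⟨a, b, h⟩ | ⟨a, b, h⟩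
    · exact Or.inl ⟨c * d, fun x => by simp only [h]⟩
    · exact Or.inr (Or.inl ⟨c * a, b, fun x => by simp only [h, mul_assoc]⟩)
    · exact Or.inr (Or.inr ⟨c * a, b, fun x => by simp only [h, mul_assoc]⟩)
  | inv t _ ih =>
    rcases ih with ⟨d, h⟩ | ⟨a, b, h⟩ | ⟨a, b, h⟩
    · exact Or.inl ⟨d⁻¹, fun x => by simp only [h]⟩
    · exact Or.inr (Or.inr ⟨b⁻¹, a⁻¹, fun x => by simp only [h, mul_inv_rev, mul_assoc]⟩)
    · exact Or.inr (Or.inl ⟨b⁻¹, a⁻¹, fun x => by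
        simp only [h, mul_inv_rev, inv_inv, mul_assoc]⟩)
end

section
/- Let A and B be lattices and let θ be a congruence on the product lattice A × B (with componentwise operations). Then there exist a congruence θ_A on A and a congruence θ_B on B such that for all (a,b), (a',b') ∈ A × B: (a,b) θ (a',b') if and only if a θ_A a' and b θ_B b'. (The variety of lattices has the congruence-product property.) -/
/-- A congruence on a lattice `L`: an equivalence relation compatible with meet and
join. -/
def IsLatticeCongruence {L : Type*} [Lattice L] (θ : L → L → Prop) : Prop :=
  Equivalence θ ∧
    ∀ a a' b b' : L, θ a a' → θ b b' → θ (a ⊓ b) (a' ⊓ b') ∧ θ (a ⊔ b) (a' ⊔ b')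

namespace IsLatticeCongruence

variable {A B : Type*} [Lattice A] [Lattice B] {θ : A × B → A × B → Prop}

theorem fst_const (hθ : IsLatticeCongruence θ) {a a' : A} {b b' : B}
    (h : θ (a, b) (a', b')) (c : B) : θ (a, c) (a', c) := by
  have hsup := (hθ.2 _ _ _ _ h (hθ.1.refl (a ⊓ a', b ⊔ b' ⊔ c))).2
  have hinf := (hθ.2 _ _ _ _ hsup (hθ.1.refl (a ⊔ a', c))).1
  have e : (b ⊔ (b ⊔ b' ⊔ c)) ⊓ c = c := inf_eq_right.2 (le_sup_of_le_right le_sup_right)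
  have e' : (b' ⊔ (b ⊔ b' ⊔ c)) ⊓ c = c := inf_eq_right.2 (le_sup_of_le_right le_sup_right)
  simpa [e, e'] using hinf

theorem snd_const (hθ : IsLatticeCongruence θ) {a a' : A} {b b' : B}
    (h : θ (a, b) (a', b')) (c : A) : θ (c, b) (c, b') := by
  have hsup := (hθ.2 _ _ _ _ h (hθ.1.refl (a ⊔ a' ⊔ c, b ⊓ b'))).2
  have hinf := (hθ.2 _ _ _ _ hsup (hθ.1.refl (c, b ⊔ b'))).1
  have e : (a ⊔ (a ⊔ a' ⊔ c)) ⊓ c = c := inf_eq_right.2 (le_sup_of_le_right le_sup_right)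
  have e' : (a' ⊔ (a ⊔ a' ⊔ c)) ⊓ c = c := inf_eq_right.2 (le_sup_of_le_right le_sup_right)
  simpa [e, e'] using hinf

theorem forall_fst (hθ : IsLatticeCongruence θ) :
    IsLatticeCongruence fun a a' : A => ∀ b : B, θ (a, b) (a', b) := by
  refine ⟨⟨fun _ _ => hθ.1.refl _, fun h b => hθ.1.symm (h b),
    fun h h' b => hθ.1.trans (h b) (h' b)⟩, fun _ _ _ _ h h' => ⟨fun b => ?_, fun b => ?_⟩⟩
  · simpa using (hθ.2 _ _ _ _ (h b) (h' b)).1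
  · simpa using (hθ.2 _ _ _ _ (h b) (h' b)).2

theorem forall_snd (hθ : IsLatticeCongruence θ) :
    IsLatticeCongruence fun b b' : B => ∀ a : A, θ (a, b) (a, b') := by
  refine ⟨⟨fun _ _ => hθ.1.refl _, fun h a => hθ.1.symm (h a),
    fun h h' a => hθ.1.trans (h a) (h' a)⟩, fun _ _ _ _ h h' => ⟨fun a => ?_, fun a => ?_⟩⟩
  · simpa using (hθ.2 _ _ _ _ (h a) (h' a)).1
  · simpa using (hθ.2 _ _ _ _ (h a) (h' a)).2

end IsLatticeCongruence

/-- The variety of lattices has the congruence-product property: every congruence on a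
product lattice `A × B` (componentwise operations) is the product of a congruence on
`A` and a congruence on `B`. -/
theorem stmt16 {A B : Type*} [Lattice A] [Lattice B]
    (θ : A × B → A × B → Prop) (hθ : IsLatticeCongruence θ) :
    ∃ (θA : A → A → Prop) (θB : B → B → Prop),
      IsLatticeCongruence θA ∧ IsLatticeCongruence θB ∧
      ∀ (a a' : A) (b b' : B), θ (a, b) (a', b') ↔ θA a a' ∧ θB b b' := by
  exact ⟨_, _, hθ.forall_fst, hθ.forall_snd, fun a a' b b' =>
    ⟨fun h => ⟨hθ.fst_const h, hθ.snd_const h⟩, fun h => hθ.1.trans (h.1 b) (h.2 a')⟩⟩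
end
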